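/- arXiv:2210.07698 — 14 statements merged into one kernel-verified Lean document; each statement's English description precedes it below -/
import Mathlib

section
/- Let V be a real vector space and m ≥ 1 a natural number. Let Ω̃ be an alternating (m+1)-form on V, ω an alternating m-form on V, and α a linear functional on V, and set Ω = Ω̃ + α ∧ ω (wedge product of the 1-form α with the m-form ω). Suppose the vectors X₀, …, X_{m−1} ∈ V satisfy ω(X₀,…,X_{m−1}) ≠ 0 and Ω(X₀,…,X_{m−1}, z) = 0 for every z ∈ V. Then every vector Z ∈ V such that Ω̃(Z, w₁, …, w_m) = 0 for all w₁,…,w_m ∈ V and ω(Z, w₁, …, w_{m−1}) = 0 for all w₁,…,w_{m−1} ∈ V satisfies α(Z) = 0. -/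
/-- If an alternating form vanishes whenever its first argument is `Z`, then it vanishes whenever
any of its arguments is `Z`. -/
theorem AlternatingMap.eq_zero_of_forall_cons_eq_zero {R M N : Type*} [CommRing R]
    [AddCommGroup M] [Module R M] [AddCommGroup N] [Module R N] {n : ℕ}
    (f : AlternatingMap R M N (Fin (n + 1))) {Z : M}
    (hZ : ∀ w : Fin n → M, f (Fin.cons Z w) = 0)
    {v : Fin (n + 1) → M} {i : Fin (n + 1)} (hv : v i = Z) : f v = 0 := by
  have hcons : v ∘ Equiv.swap 0 i = Fin.cons Z (Fin.tail (v ∘ Equiv.swap 0 i)) := by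
    conv_lhs => rw [← Fin.cons_self_tail (v ∘ Equiv.swap 0 i)]
    simp [hv]
  have hperm := f.map_perm v (Equiv.swap 0 i)
  rw [hcons, hZ] at hperm
  exact (smul_eq_zero_iff_eq _).mp hperm.symm

/-- Proposition 1, pointwise form.
`m = k + 1 ≥ 1`. `Ω = Ω̃ + α ∧ ω` where the wedge of the 1-form `α` with the `m`-form `ω`
is given by `(α ∧ ω)(v₀,…,v_m) = ∑ j, (−1)^j α(v_j) ω(v₀,…,v̂_j,…,v_m)`.
If the vectors `X₀,…,X_{m−1}` satisfy `ω(X) ≠ 0` and `Ω(X₀,…,X_{m−1},z) = 0` for all `z`,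
then any `Z` with `Ω̃(Z,·,…,·) = 0` and `ω(Z,·,…,·) = 0` satisfies `α Z = 0`. -/
theorem stmt0 (V : Type*) [AddCommGroup V] [Module ℝ V] (k : ℕ)
    (Ω' : AlternatingMap ℝ V ℝ (Fin (k + 2)))
    (ω : AlternatingMap ℝ V ℝ (Fin (k + 1)))
    (α : V →ₗ[ℝ] ℝ)
    (X : Fin (k + 1) → V)
    (hX : ω X ≠ 0)
    (hsol : ∀ z : V,
      Ω' (Fin.snoc X z) +
        ∑ j : Fin (k + 2), (-1 : ℝ) ^ (j : ℕ) * α ((Fin.snoc X z : Fin (k + 2) → V) j) *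
          ω (fun i : Fin (k + 1) => (Fin.snoc X z : Fin (k + 2) → V) (j.succAbove i)) = 0)
    (Z : V)
    (hZΩ : ∀ w : Fin (k + 1) → V, Ω' (Fin.cons Z w) = 0)
    (hZω : ∀ w : Fin k → V, ω (Fin.cons Z w) = 0) :
    α Z = 0 := by
  have hΩ : Ω' (Fin.snoc X Z) = 0 :=
    Ω'.eq_zero_of_forall_cons_eq_zero hZΩ (i := Fin.last (k + 1)) (by simp)
  have hω (j : Fin (k + 1)) :
      ω (fun i => (Fin.snoc X Z : Fin (k + 2) → V) (j.castSucc.succAbove i)) = 0 := by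
    refine ω.eq_zero_of_forall_cons_eq_zero hZω (i := Fin.last k) ?_
    rw [Fin.succAbove_castSucc_of_le _ _ (Fin.le_last j), Fin.succ_last, Fin.snoc_last]
  have h := hsol Z
  rw [hΩ, Fin.sum_univ_castSucc] at h
  simpa [hω, hX] using h
end

section
/- For every point q = (x, y, v) of the multivelocity space and all indices B : Fin n and ν : Fin m, one has Σ_{A : Fin n} Σ_{μ : Fin m} (∂ζ/∂p_{Aμ})(FL q) · (∂²L/∂v_{Bν} ∂v_{Aμ})(q) = 0. In other words, for every primary constraint ζ arising from the Legendre map, the vector with components γ_{Aμ} = (∂ζ/∂p_{Aμ}) ∘ FL annihilates the generalized Hessian of the Lagrangian with respect to the multivelocities. -/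
/-- Points of the multivelocity space: spacetime coordinates, fields, multivelocities. -/
abbrev JetSpace (m n : ℕ) : Type :=
  (Fin m → ℝ) × (Fin n → ℝ) × (Fin n → Fin m → ℝ)

/-- The standard basis vector in the `(A, μ)` multivelocity direction. -/
noncomputable def eVel (m n : ℕ) (A : Fin n) (μ : Fin m) : JetSpace m n :=
  (0, 0, Pi.single A (Pi.single μ 1))

/-- The standard basis vector in the `y_B` field direction. -/
noncomputable def eField (m n : ℕ) (B : Fin n) : JetSpace m n :=
  (0, Pi.single B 1, 0)

/-- The De Donder–Weyl Legendre map: `p A μ = ∂L/∂v_{Aμ}`. -/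
noncomputable def LegendreMap (m n : ℕ) (L : JetSpace m n → ℝ) (q : JetSpace m n) :
    JetSpace m n :=
  (q.1, q.2.1, fun A μ => fderiv ℝ L q (eVel m n A μ))

/-- A vector in a pure multivelocity direction expands in the standard basis. -/
theorem sum_smul_eVel (m n : ℕ) (w : Fin n → Fin m → ℝ) :
    ∑ A : Fin n, ∑ μ : Fin m, w A μ • eVel m n A μ = ((0, 0, w) : JetSpace m n) := by
  refine Prod.ext ?_ (Prod.ext ?_ ?_)
  · simp [eVel, Prod.fst_sum]
  · simp [eVel, Prod.fst_sum, Prod.snd_sum]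
  · ext A μ
    simp [eVel, Prod.snd_sum, Finset.sum_apply, Pi.single_apply, ite_apply]

/-- The derivative of the Legendre map, in terms of the second derivative of `L`. -/
theorem hasFDerivAt_LegendreMap (m n : ℕ) {L : JetSpace m n → ℝ} {q : JetSpace m n}
    (hL : DifferentiableAt ℝ (fderiv ℝ L) q) :
    HasFDerivAt (LegendreMap m n L)
      ((ContinuousLinearMap.fst ℝ _ _).prod
        (((ContinuousLinearMap.fst ℝ _ _).comp (ContinuousLinearMap.snd ℝ _ _)).prod
          (ContinuousLinearMap.pi fun A => ContinuousLinearMap.pi fun μ =>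
            (fderiv ℝ (fderiv ℝ L) q).flip (eVel m n A μ)))) q := by
  refine hasFDerivAt_fst.prodMk ((hasFDerivAt_fst.comp q hasFDerivAt_snd).prodMk ?_)
  refine hasFDerivAt_pi.2 fun A => hasFDerivAt_pi.2 fun μ => ?_
  exact (ContinuousLinearMap.apply ℝ ℝ (eVel m n A μ)).hasFDerivAt.comp q hL.hasFDerivAt

/-- Proposition 2, in coordinates: for every primary constraint `ζ` arising
from the Legendre map of `L`, the vector with components `γ_{Aμ} = (∂ζ/∂p_{Aμ}) ∘ FL`
annihilates the generalized Hessian `∂²L/∂v_{Bν}∂v_{Aμ}`. -/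
theorem stmt2 (m n : ℕ) (hm : 1 ≤ m) (hn : 1 ≤ n)
    (L : JetSpace m n → ℝ) (hL : ContDiff ℝ 2 L)
    (ζ : JetSpace m n → ℝ) (hζ : ContDiff ℝ 1 ζ)
    (hconstraint : ∀ q : JetSpace m n, ζ (LegendreMap m n L q) = 0) :
    ∀ (q : JetSpace m n) (B : Fin n) (ν : Fin m),
      ∑ A : Fin n, ∑ μ : Fin m,
        fderiv ℝ ζ (LegendreMap m n L q) (eVel m n A μ) *
          fderiv ℝ (fderiv ℝ L) q (eVel m n B ν) (eVel m n A μ) = 0 := by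
  intro q B ν
  have hL' : DifferentiableAt ℝ (fderiv ℝ L) q :=
    (hL.fderiv_right (m := 1) (by norm_num)).differentiable (by norm_num) q
  have hζ' : DifferentiableAt ℝ ζ (LegendreMap m n L q) :=
    hζ.differentiable (by norm_num) _
  have hcomp := hζ'.hasFDerivAt.comp q (hasFDerivAt_LegendreMap m n hL')
  have hzero : ζ ∘ LegendreMap m n L = fun _ => 0 := funext hconstraint
  rw [hzero] at hcomp
  have happ := DFunLike.congr_fun (hcomp.unique (hasFDerivAt_const (0 : ℝ) q)) (eVel m n B ν)
  have hw := sum_smul_eVel m n fun A μ =>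
    fderiv ℝ (fderiv ℝ L) q (eVel m n B ν) (eVel m n A μ)
  have hker : fderiv ℝ ζ (LegendreMap m n L q)
      (0, 0, fun A μ => fderiv ℝ (fderiv ℝ L) q (eVel m n B ν) (eVel m n A μ)) = 0 := happ
  rw [← hw] at hker
  simpa only [map_sum, map_smul, smul_eq_mul, mul_comm] using hker
end

section
/- Let X be a real D × m matrix with det(Xᵀ * G * X) < 0 and set g = Xᵀ * G * X. Then the Nambu–Goto Lagrangian L is Fréchet differentiable at X, and for every real D × m matrix H: (fderiv ℝ L X) H = −T · Real.sqrt(−det g) · Matrix.trace(g⁻¹ * Xᵀ * G * H). Componentwise this is the paper's formula ∂L/∂x^μ_a = −T √(−det g) G_{μν} g^{ba} x^ν_b for the De Donder–Weyl multimomenta of the Nambu–Goto p-brane. -/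
open Matrix

attribute [local instance] Matrix.normedAddCommGroup Matrix.normedSpace

/-- The determinant of real square matrices is differentiable. -/
theorem differentiable_det {n : Type*} [Fintype n] [DecidableEq n] :
    Differentiable ℝ (fun A : Matrix n n ℝ => A.det) := by
  have entry (i j : n) : Differentiable ℝ (fun A : Matrix n n ℝ => A i j) :=
    ((LinearMap.toContinuousLinearMap (Matrix.entryLinearMap ℝ ℝ i j))).differentiable
  simp only [Matrix.det_apply']
  fun_prop

/-- Jacobi's formula for the derivative of the determinant at an invertible matrix. -/
theorem fderiv_det {n : Type*} [Fintype n] [DecidableEq n] {A : Matrix n n ℝ}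
    (hA : IsUnit A.det) (K : Matrix n n ℝ) :
    fderiv ℝ (fun A : Matrix n n ℝ => A.det) A K = A.det * (A⁻¹ * K).trace := by
  have line : HasDerivAt (fun t : ℝ => (A + t • K).det) (A.det * (A⁻¹ * K).trace) 0 := by
    let q := (Matrix.det (1 + (Polynomial.X : Polynomial ℝ) •
      (A⁻¹ * K).map Polynomial.C)).divX.divX
    have expand : (fun t : ℝ => (A + t • K).det) =
        fun t => A.det * (1 + (A⁻¹ * K).trace * t + q.eval t * t ^ 2) := by
      funext t
      rw [← Matrix.det_one_add_smul, ← Matrix.det_mul, mul_add, mul_one, Matrix.mul_smul,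
        Matrix.mul_nonsing_inv_cancel_left _ _ hA]
    rw [expand]
    refine HasDerivAt.const_mul _ ?_
    have h := (((hasDerivAt_id (0 : ℝ)).const_mul (A⁻¹ * K).trace).const_add 1).add
      ((q.hasDerivAt 0).mul ((hasDerivAt_id (0 : ℝ)).pow 2))
    simpa using! h
  exact ((differentiable_det A).lineDeriv_eq_fderiv (v := K)).symm.trans line.deriv

/-- The derivative of the quadratic map `X ↦ Xᵀ G X`. -/
theorem hasFDerivAt_transpose_mul_mul {d n : Type*} [Fintype d] [Fintype n]
    (G : Matrix d d ℝ) (X : Matrix d n ℝ) :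
    ∃ f : Matrix d n ℝ →L[ℝ] Matrix n n ℝ,
      HasFDerivAt (fun X : Matrix d n ℝ => Xᵀ * G * X) f X ∧
        ∀ H, f H = Xᵀ * G * H + Hᵀ * G * X := by
  let B : Matrix d n ℝ →ₗ[ℝ] Matrix d n ℝ →ₗ[ℝ] Matrix n n ℝ :=
    LinearMap.mk₂ ℝ (fun Y Z => Yᵀ * G * Z)
      (by intros; simp [Matrix.add_mul]) (by intros; simp)
      (by intros; simp [Matrix.mul_add]) (by intros; simp)
  let b : Matrix d n ℝ →L[ℝ] Matrix d n ℝ →L[ℝ] Matrix n n ℝ :=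
    LinearMap.toContinuousLinearMap
      ((LinearMap.toContinuousLinearMap : _ ≃ₗ[ℝ] (Matrix d n ℝ →L[ℝ] Matrix n n ℝ)).toLinearMap
        ∘ₗ B)
  exact ⟨_, b.hasFDerivAt_of_bilinear (hasFDerivAt_id X) (hasFDerivAt_id X), fun H => rfl⟩

/-- The two terms of the variation of `Xᵀ G X` contribute equally to the trace. -/
theorem trace_inv_mul_transpose_mul_mul {d n : Type*} [Fintype d] [Fintype n] [DecidableEq n]
    {G : Matrix d d ℝ} (hG : Gᵀ = G) (X H : Matrix d n ℝ) :
    ((Xᵀ * G * X)⁻¹ * (Hᵀ * G * X)).trace = ((Xᵀ * G * X)⁻¹ * (Xᵀ * G * H)).trace := by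
  rw [← Matrix.trace_transpose, Matrix.transpose_mul, Matrix.transpose_nonsing_inv,
    Matrix.trace_mul_comm]
  simp [Matrix.transpose_mul, hG, Matrix.mul_assoc]

/-- Fréchet derivative of the Nambu–Goto Lagrangian
`L(X) = −T √(−det(Xᵀ G X))`: at any `X` with `det(Xᵀ G X) < 0`, `L` is differentiable and
`(fderiv ℝ L X) H = −T √(−det g) · trace(g⁻¹ Xᵀ G H)`, where `g = Xᵀ G X`. -/
theorem stmt4 (D m : ℕ) (hD : 1 ≤ D) (hm : 1 ≤ m)
    (T : ℝ) (hT : 0 < T)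
    (G : Matrix (Fin D) (Fin D) ℝ) (hGsymm : Gᵀ = G) (hGdet : IsUnit G.det)
    (L : Matrix (Fin D) (Fin m) ℝ → ℝ)
    (hLdef : L = fun X => -T * Real.sqrt (-(Xᵀ * G * X).det))
    (X : Matrix (Fin D) (Fin m) ℝ)
    (hdet : (Xᵀ * G * X).det < 0)
    (g : Matrix (Fin m) (Fin m) ℝ) (hg : g = Xᵀ * G * X) :
    DifferentiableAt ℝ L X ∧
      ∀ H : Matrix (Fin D) (Fin m) ℝ,
        fderiv ℝ L X H = -T * Real.sqrt (-g.det) * (g⁻¹ * Xᵀ * G * H).trace := by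
  subst hLdef hg
  obtain ⟨f, hf, hfH⟩ := hasFDerivAt_transpose_mul_mul G X
  have hdetX := (differentiable_det (Xᵀ * G * X)).hasFDerivAt.comp (f := fun Y => Yᵀ * G * Y) X hf
  have hL := (hdetX.neg.sqrt (neg_pos.2 hdet).ne').const_mul (-T)
  refine ⟨hL.differentiableAt, fun H => ?_⟩
  refine (congrArg (fun F => F H) hL.fderiv).trans ?_
  have hs : √(-(Xᵀ * G * X).det) ≠ 0 := (Real.sqrt_pos.2 (neg_pos.2 hdet)).ne'
  have hsq := Real.mul_self_sqrt (neg_pos.2 hdet).le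
  have htr : fderiv ℝ (fun A : Matrix (Fin m) (Fin m) ℝ => A.det) (Xᵀ * G * X) (f H)
      = (Xᵀ * G * X).det * (2 * ((Xᵀ * G * X)⁻¹ * Xᵀ * G * H).trace) := by
    rw [fderiv_det hdet.ne.isUnit, hfH, Matrix.mul_add, Matrix.trace_add,
      trace_inv_mul_transpose_mul_mul hGsymm]
    simp only [Matrix.mul_assoc]
    ring
  change -T * (1 / (2 * √(-(Xᵀ * G * X).det)) *
    -(fderiv ℝ (fun A : Matrix (Fin m) (Fin m) ℝ => A.det) (Xᵀ * G * X) (f H))) = _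
  rw [htr]
  field_simp
  rw [sq, hsq]
  ring
end

section
/- Let X be a real D × m matrix with det(Xᵀ * G * X) < 0 and set g = Xᵀ * G * X. Then the Nambu–Goto Lagrangian L is twice Fréchet differentiable at X, and for all real D × m matrices K and H its second derivative satisfies: (fderiv ℝ (fderiv ℝ L) X K) H = −T · Real.sqrt(−det g) · [ Matrix.trace(g⁻¹ * Kᵀ * G * H) + Matrix.trace(g⁻¹ * Xᵀ * G * K) · Matrix.trace(g⁻¹ * Xᵀ * G * H) − Matrix.trace(g⁻¹ * (Kᵀ * G * X + Xᵀ * G * K) * g⁻¹ * Xᵀ * G * H) ]. This is the paper's generalized Hessian H^{ab}_{μν} = ∂²L/∂x^μ_a ∂x^ν_b of the Nambu–Goto Lagrangian in invariant matrix form. -/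
open Matrix

attribute [local instance] Matrix.normedAddCommGroup Matrix.normedSpace

theorem hasDerivAt_fderiv_add_smul_apply {E F : Type*} [NormedAddCommGroup E] [NormedSpace ℝ E]
    [NormedAddCommGroup F] [NormedSpace ℝ F] {f : E → F} {x : E}
    (hf : DifferentiableAt ℝ (fderiv ℝ f) x) (v w : E) :
    HasDerivAt (fun s : ℝ => fderiv ℝ f (x + s • v) w) (fderiv ℝ (fderiv ℝ f) x v w) 0 := by
  have hline : HasDerivAt (fun s : ℝ => x + s • v) v 0 := by
    simpa using ((hasDerivAt_id (0 : ℝ)).smul_const v).const_add x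
  have hf' : HasFDerivAt (fderiv ℝ f) (fderiv ℝ (fderiv ℝ f) x) (x + (0 : ℝ) • v) := by
    simpa using hf.hasFDerivAt
  exact (ContinuousLinearMap.apply ℝ F w).hasFDerivAt.comp_hasDerivAt (0 : ℝ)
    (hf'.comp_hasDerivAt (0 : ℝ) hline)

section MatrixCalculus

variable {l m n : Type*} [Fintype l] [Fintype m] [Fintype n]

theorem hasDerivAt_matrix {m n : Type*} [Fintype m] [Fintype n] {A : ℝ → Matrix m n ℝ} {A' : Matrix m n ℝ} {t : ℝ} :
    HasDerivAt A A' t ↔ ∀ i j, HasDerivAt (fun s => A s i j) (A' i j) t :=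
  Iff.trans hasDerivAt_pi (forall_congr' fun _ => hasDerivAt_pi)

theorem hasDerivAt_add_smul (X K : Matrix m n ℝ) (t : ℝ) :
    HasDerivAt (fun s : ℝ => X + s • K) K t := by
  rw [hasDerivAt_matrix]
  intro i j
  simpa using ((hasDerivAt_id t).mul_const (K i j)).const_add (X i j)

theorem HasDerivAt.matrix_mul {A : ℝ → Matrix l m ℝ} {B : ℝ → Matrix m n ℝ}
    {A' : Matrix l m ℝ} {B' : Matrix m n ℝ} {t : ℝ}
    (hA : HasDerivAt A A' t) (hB : HasDerivAt B B' t) :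
    HasDerivAt (fun s => A s * B s) (A' * B t + A t * B') t := by
  rw [hasDerivAt_matrix] at *
  intro i j
  simp only [Matrix.mul_apply, Matrix.add_apply, ← Finset.sum_add_distrib]
  exact HasDerivAt.fun_sum fun k _ => (hA i k).mul (hB k j)

theorem HasDerivAt.matrix_transpose {A : ℝ → Matrix m n ℝ} {A' : Matrix m n ℝ} {t : ℝ}
    (hA : HasDerivAt A A' t) : HasDerivAt (fun s => (A s)ᵀ) A'ᵀ t := by
  rw [hasDerivAt_matrix] at *
  exact fun i j => hA j i

theorem HasDerivAt.matrix_trace {A : ℝ → Matrix n n ℝ} {A' : Matrix n n ℝ} {t : ℝ}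
    (hA : HasDerivAt A A' t) : HasDerivAt (fun s => (A s).trace) A'.trace t := by
  rw [hasDerivAt_matrix] at hA
  exact HasDerivAt.fun_sum fun i _ => hA i i

theorem HasDerivAt.matrix_inv [DecidableEq n] {A : ℝ → Matrix n n ℝ} {A' : Matrix n n ℝ}
    {t : ℝ} (hA : HasDerivAt A A' t) (hdet : (A t).det ≠ 0) :
    HasDerivAt (fun s => (A s)⁻¹) (-((A t)⁻¹ * A' * (A t)⁻¹)) t := by
  let _ := Matrix.linftyOpNormedRing (α := ℝ) (n := n)
  let _ := Matrix.linftyOpNormedAlgebra (R := ℝ) (α := ℝ) (n := n)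
  have hcomplete : CompleteSpace (Matrix n n ℝ) := inferInstanceAs (CompleteSpace (n → n → ℝ))
  have : HasSummableGeomSeries (Matrix n n ℝ) :=
    @instHasSummableGeomSeriesOfCompleteSpace _ _ hcomplete
  obtain ⟨u, hu⟩ := (Matrix.isUnit_iff_isUnit_det _).2 hdet.isUnit
  have hinv := hasFDerivAt_ringInverse (𝕜 := ℝ) u
  rw [hu] at hinv
  have hcomp := hinv.comp_hasDerivAt t hA
  have hu_inv : (↑u⁻¹ : Matrix n n ℝ) = (A t)⁻¹ := by rw [← hu, Matrix.coe_units_inv]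
  have hfun : (fun s => (A s)⁻¹) = Ring.inverse ∘ A :=
    funext fun s => Matrix.nonsing_inv_eq_ringInverse (A s)
  simp only [hu_inv, _root_.neg_apply,
    ContinuousLinearMap.mulLeftRight_apply] at hcomp
  rw [hfun]
  exact hcomp

theorem Matrix.contDiff_mul {k : WithTop ℕ∞} {E : Type*} [NormedAddCommGroup E]
    [NormedSpace ℝ E] {A : E → Matrix l m ℝ} {B : E → Matrix m n ℝ}
    (hA : ContDiff ℝ k A) (hB : ContDiff ℝ k B) : ContDiff ℝ k fun x => A x * B x := by
  refine contDiff_pi.2 fun i => contDiff_pi.2 fun j => ?_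
  simp only [Matrix.mul_apply]
  exact ContDiff.sum fun p _ => ((contDiff_apply_apply ℝ ℝ i p).comp hA).mul
    ((contDiff_apply_apply ℝ ℝ p j).comp hB)

theorem Matrix.contDiff_transpose {k : WithTop ℕ∞} :
    ContDiff ℝ k (Matrix.transpose : Matrix m n ℝ → Matrix n m ℝ) :=
  contDiff_pi.2 fun i => contDiff_pi.2 fun j => contDiff_apply_apply ℝ ℝ j i

theorem Matrix.contDiff_det [DecidableEq n] {k : WithTop ℕ∞} :
    ContDiff ℝ k (Matrix.det : Matrix n n ℝ → ℝ) := by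
  have h : (Matrix.det : Matrix n n ℝ → ℝ) =
      fun A => ∑ σ : Equiv.Perm n, ((Equiv.Perm.sign σ : ℤ) : ℝ) * ∏ i, A (σ i) i :=
    funext Matrix.det_apply'
  rw [h]
  exact ContDiff.sum fun σ _ => contDiff_const.mul
    (contDiff_prod fun i _ => contDiff_apply_apply ℝ ℝ (σ i) i)

theorem hasDerivAt_det_one_add_smul [DecidableEq n] (M : Matrix n n ℝ) :
    HasDerivAt (fun s : ℝ => (1 + s • M).det) M.trace 0 := by
  let p := (1 + (Polynomial.X : Polynomial ℝ) • M.map Polynomial.C).det.divX.divX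
  have h := (((hasDerivAt_id (0 : ℝ)).const_mul M.trace).const_add 1).add
    ((p.hasDerivAt 0).mul (hasDerivAt_pow 2 (0 : ℝ)))
  have hfun : (fun s : ℝ => (1 + s • M).det) =
      fun s => 1 + M.trace * s + p.eval s * s ^ 2 :=
    funext fun s => Matrix.det_one_add_smul s M
  rw [hfun]
  exact h.congr_deriv (by simp)

/-- Jacobi's formula at an invertible matrix. -/
theorem HasDerivAt.matrix_det [DecidableEq n] {A : ℝ → Matrix n n ℝ} {A' : Matrix n n ℝ}
    {t : ℝ} (hA : HasDerivAt A A' t) (hdet : (A t).det ≠ 0) :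
    HasDerivAt (fun s => (A s).det) ((A t).det * ((A t)⁻¹ * A').trace) t := by
  have hd : HasFDerivAt Matrix.det (fderiv ℝ Matrix.det (A t)) (A t) :=
    ((Matrix.contDiff_det (k := 1)).differentiable one_ne_zero _).hasFDerivAt
  have hd' : HasFDerivAt Matrix.det (fderiv ℝ Matrix.det (A t)) (A t + (0 : ℝ) • A') := by
    rwa [zero_smul, add_zero]
  have h₁ := hd'.comp_hasDerivAt (0 : ℝ) (hasDerivAt_add_smul (A t) A' 0)
  have h₂ := (hasDerivAt_det_one_add_smul ((A t)⁻¹ * A')).const_mul (A t).det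
  have hfun : (fun s : ℝ => (A t).det * (1 + s • ((A t)⁻¹ * A')).det) =
      Matrix.det ∘ fun s : ℝ => A t + s • A' := by
    funext s
    rw [← Matrix.det_mul, Matrix.mul_add, Matrix.mul_one, Matrix.mul_smul,
      Matrix.mul_nonsing_inv_cancel_left _ _ hdet.isUnit, Function.comp_apply]
  rw [hfun] at h₂
  rw [← h₁.unique h₂]
  exact hd.comp_hasDerivAt t hA

end MatrixCalculus

section NambuGoto

variable {m n : Type*} [Fintype m] [Fintype n]

theorem hasDerivAt_inducedMetric (G : Matrix m m ℝ) (X K : Matrix m n ℝ) :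
    HasDerivAt (fun s : ℝ => (X + s • K)ᵀ * G * (X + s • K)) (Kᵀ * G * X + Xᵀ * G * K) 0 := by
  have h := hasDerivAt_add_smul X K 0
  simpa using (h.matrix_transpose.matrix_mul (hasDerivAt_const 0 G)).matrix_mul h

variable [DecidableEq n]

/-- The Nambu–Goto Lagrangian `−T √(−det(Xᵀ G X))`. -/
noncomputable def nambuGoto (T : ℝ) (G : Matrix m m ℝ) (X : Matrix m n ℝ) : ℝ :=
  -T * Real.sqrt (-(Xᵀ * G * X).det)

variable {T : ℝ} {G : Matrix m m ℝ} {X : Matrix m n ℝ}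

theorem contDiff_inducedMetric_det {k : WithTop ℕ∞} (G : Matrix m m ℝ) :
    ContDiff ℝ k fun Y : Matrix m n ℝ => (Yᵀ * G * Y).det :=
  Matrix.contDiff_det.comp (Matrix.contDiff_mul
    (Matrix.contDiff_mul Matrix.contDiff_transpose contDiff_const) contDiff_id)

theorem contDiffAt_nambuGoto {k : WithTop ℕ∞} (hdet : (Xᵀ * G * X).det < 0) :
    ContDiffAt ℝ k (nambuGoto T G) X :=
  contDiffAt_const.mul
    ((contDiff_inducedMetric_det G).contDiffAt.neg.sqrt (neg_ne_zero.2 hdet.ne))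

theorem trace_inv_mul_inducedMetric_variation (hG : Gᵀ = G) (X H : Matrix m n ℝ) :
    ((Xᵀ * G * X)⁻¹ * (Hᵀ * G * X + Xᵀ * G * H)).trace =
      2 * ((Xᵀ * G * X)⁻¹ * Xᵀ * G * H).trace := by
  have hg : (Xᵀ * G * X)ᵀ = Xᵀ * G * X := by
    simp only [Matrix.transpose_mul, Matrix.transpose_transpose, hG, Matrix.mul_assoc]
  have h : ((Xᵀ * G * X)⁻¹ * (Hᵀ * G * X)).trace = ((Xᵀ * G * X)⁻¹ * (Xᵀ * G * H)).trace := by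
    rw [← Matrix.trace_transpose, Matrix.transpose_mul, Matrix.transpose_nonsing_inv, hg,
      Matrix.trace_mul_comm]
    simp only [Matrix.transpose_mul, Matrix.transpose_transpose, hG, Matrix.mul_assoc]
  rw [Matrix.mul_add, Matrix.trace_add, h, two_mul]
  simp only [Matrix.mul_assoc]

theorem hasDerivAt_nambuGoto (hG : Gᵀ = G) (hdet : (Xᵀ * G * X).det < 0) (H : Matrix m n ℝ) :
    HasDerivAt (fun s : ℝ => nambuGoto T G (X + s • H))
      (nambuGoto T G X * ((Xᵀ * G * X)⁻¹ * Xᵀ * G * H).trace) 0 := by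
  have h := (hasDerivAt_inducedMetric G X H).matrix_det (by simpa using hdet.ne)
  have hs := (h.neg.sqrt (by simpa using hdet.ne)).const_mul (-T)
  refine hs.congr_deriv ?_
  simp only [Pi.neg_apply, zero_smul, add_zero, trace_inv_mul_inducedMetric_variation hG, nambuGoto]
  have hpos : 0 < -(Xᵀ * G * X).det := neg_pos.2 hdet
  have hne := (Real.sqrt_pos.2 hpos).ne'
  have hsq := Real.sq_sqrt hpos.le
  field_simp
  rw [hsq]
  ring

theorem fderiv_nambuGoto_apply (hG : Gᵀ = G) (hdet : (Xᵀ * G * X).det < 0)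
    (H : Matrix m n ℝ) :
    fderiv ℝ (nambuGoto T G) X H =
      nambuGoto T G X * ((Xᵀ * G * X)⁻¹ * Xᵀ * G * H).trace := by
  have hL : HasFDerivAt (nambuGoto T G) (fderiv ℝ (nambuGoto T G) X) (X + (0 : ℝ) • H) := by
    rw [zero_smul, add_zero]
    exact ((contDiffAt_nambuGoto (k := 1) hdet).differentiableAt one_ne_zero).hasFDerivAt
  have h := hL.comp_hasDerivAt (0 : ℝ) (hasDerivAt_add_smul X H 0)
  exact h.unique
    (hasDerivAt_nambuGoto hG hdet H)

theorem differentiableAt_fderiv_nambuGoto (hdet : (Xᵀ * G * X).det < 0) :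
    DifferentiableAt ℝ (fderiv ℝ (nambuGoto T G)) X :=
  ((contDiffAt_nambuGoto (k := 2) hdet).fderiv_right (m := 1)
    (by norm_num)).differentiableAt one_ne_zero

theorem fderiv_fderiv_nambuGoto_apply (hG : Gᵀ = G) (hdet : (Xᵀ * G * X).det < 0)
    (K H : Matrix m n ℝ) :
    fderiv ℝ (fderiv ℝ (nambuGoto T G)) X K H =
      nambuGoto T G X *
        (((Xᵀ * G * X)⁻¹ * Kᵀ * G * H).trace
          + ((Xᵀ * G * X)⁻¹ * Xᵀ * G * K).trace * ((Xᵀ * G * X)⁻¹ * Xᵀ * G * H).trace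
          - ((Xᵀ * G * X)⁻¹ * (Kᵀ * G * X + Xᵀ * G * K) * (Xᵀ * G * X)⁻¹
              * Xᵀ * G * H).trace) := by
  have hline := hasDerivAt_add_smul X K 0
  have h₁ := hasDerivAt_fderiv_add_smul_apply
    (differentiableAt_fderiv_nambuGoto (T := T) hdet) K H
  have hinv := (hasDerivAt_inducedMetric G X K).matrix_inv (by simpa using hdet.ne)
  have htrace := (((hinv.matrix_mul hline.matrix_transpose).matrix_mul
    (hasDerivAt_const 0 G)).matrix_mul (hasDerivAt_const 0 H)).matrix_trace
  have h₂ := (hasDerivAt_nambuGoto (T := T) hG hdet K).mul htrace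
  have hnear : ∀ᶠ s : ℝ in nhds 0, ((X + s • K)ᵀ * G * (X + s • K)).det < 0 := by
    have hcont : ContinuousAt (fun s : ℝ => ((X + s • K)ᵀ * G * (X + s • K)).det) 0 :=
      (contDiff_inducedMetric_det (k := 1) G).continuous.continuousAt.comp hline.continuousAt
    exact hcont.eventually_lt continuousAt_const (by simpa using hdet)
  have h := h₁.unique (h₂.congr_of_eventuallyEq
    (hnear.mono fun s hs => fderiv_nambuGoto_apply hG hs H))
  simp only [add_zero, zero_smul, Matrix.mul_zero, Matrix.add_mul, Matrix.neg_mul,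
    Matrix.trace_add, Matrix.trace_neg] at h
  refine h.trans ?_
  simp only [Matrix.mul_add, Matrix.add_mul, Matrix.trace_add]
  ring

end NambuGoto

/-- the generalized Hessian of the Nambu–Goto Lagrangian
`L(X) = −T √(−det(Xᵀ G X))` in invariant matrix form: at any `X` with `det(Xᵀ G X) < 0`,
`L` is twice differentiable and
`(fderiv ℝ (fderiv ℝ L) X K) H = −T √(−det g) [ trace(g⁻¹ Kᵀ G H)
  + trace(g⁻¹ Xᵀ G K) trace(g⁻¹ Xᵀ G H) − trace(g⁻¹ (Kᵀ G X + Xᵀ G K) g⁻¹ Xᵀ G H) ]`. -/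
theorem stmt5 (D m : ℕ) (hD : 1 ≤ D) (hm : 1 ≤ m)
    (T : ℝ) (hT : 0 < T)
    (G : Matrix (Fin D) (Fin D) ℝ) (hGsymm : Gᵀ = G) (hGdet : IsUnit G.det)
    (L : Matrix (Fin D) (Fin m) ℝ → ℝ)
    (hLdef : L = fun X => -T * Real.sqrt (-(Xᵀ * G * X).det))
    (X : Matrix (Fin D) (Fin m) ℝ)
    (hdet : (Xᵀ * G * X).det < 0)
    (g : Matrix (Fin m) (Fin m) ℝ) (hg : g = Xᵀ * G * X) :
    DifferentiableAt ℝ L X ∧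
    DifferentiableAt ℝ (fderiv ℝ L) X ∧
      ∀ K H : Matrix (Fin D) (Fin m) ℝ,
        fderiv ℝ (fderiv ℝ L) X K H =
          -T * Real.sqrt (-g.det) *
            ((g⁻¹ * Kᵀ * G * H).trace
              + (g⁻¹ * Xᵀ * G * K).trace * (g⁻¹ * Xᵀ * G * H).trace
              - (g⁻¹ * (Kᵀ * G * X + Xᵀ * G * K) * g⁻¹ * Xᵀ * G * H).trace) := by
  subst hg
  obtain rfl : L = nambuGoto T G := hLdef
  exact ⟨(contDiffAt_nambuGoto (k := 1) hdet).differentiableAt one_ne_zero,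
    differentiableAt_fderiv_nambuGoto hdet, fderiv_fderiv_nambuGoto_apply hGsymm hdet⟩
end

section
/- Let X be a real D × m matrix with det(Xᵀ * G * X) < 0 and set g = Xᵀ * G * X. Then the Lagrangian energy of the Nambu–Goto Lagrangian satisfies (fderiv ℝ L X) X − L(X) = −(m − 1) · T · Real.sqrt(−det g). That is, for an m = (p+1)-dimensional worldvolume, E_L = Σ_{a,μ} (∂L/∂x^μ_a) x^μ_a − L = −p · T · √(−det g). -/
open Matrix

attribute [local instance] Matrix.normedAddCommGroup Matrix.normedSpace

/-- Euler's theorem on homogeneous functions, for positive scalings. -/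
theorem fderiv_apply_self_of_homogeneous {E : Type*} [NormedAddCommGroup E] [NormedSpace ℝ E]
    {f : E → ℝ} {x : E} (m : ℕ) (hf : DifferentiableAt ℝ f x)
    (hom : ∀ t : ℝ, 0 < t → f (t • x) = t ^ m * f x) :
    fderiv ℝ f x x = m * f x := by
  have hline : HasDerivAt (fun t : ℝ => t • x) x 1 := by
    simpa using (hasDerivAt_id (1 : ℝ)).smul_const x
  have hcomp : HasDerivAt (fun t : ℝ => f (t • x)) (fderiv ℝ f x x) 1 := by
    have hf' : HasFDerivAt f (fderiv ℝ f x) ((1 : ℝ) • x) := by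
      simpa using hf.hasFDerivAt
    exact hf'.comp_hasDerivAt 1 hline
  have hpow : HasDerivAt (fun t : ℝ => t ^ m * f x) (m * f x) 1 := by
    simpa using (hasDerivAt_pow m (1 : ℝ)).mul_const (f x)
  refine hcomp.unique (hpow.congr_of_eventuallyEq ?_)
  filter_upwards [lt_mem_nhds (zero_lt_one' ℝ)] with t ht using hom t ht

theorem differentiable_det_transpose_mul_mul {D m : ℕ} (G : Matrix (Fin D) (Fin D) ℝ) :
    Differentiable ℝ fun X : Matrix (Fin D) (Fin m) ℝ => (Xᵀ * G * X).det := by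
  have entry (i : Fin D) (j : Fin m) :
      Differentiable ℝ fun X : Matrix (Fin D) (Fin m) ℝ => X i j :=
    (Matrix.entryLinearMap ℝ ℝ i j).toContinuousLinearMap.differentiable
  simp only [Matrix.det_apply', Matrix.mul_apply, Matrix.transpose_apply]
  fun_prop

theorem sqrt_neg_det_smul {D m : ℕ} (G : Matrix (Fin D) (Fin D) ℝ)
    (X : Matrix (Fin D) (Fin m) ℝ) {t : ℝ} (ht : 0 ≤ t) :
    √(-((t • X)ᵀ * G * (t • X)).det) = t ^ m * √(-(Xᵀ * G * X).det) := by
  have hdet : -((t • X)ᵀ * G * (t • X)).det = (t ^ m) ^ 2 * -(Xᵀ * G * X).det := by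
    simp only [Matrix.transpose_smul, Matrix.smul_mul, Matrix.mul_smul, Matrix.det_smul,
      Fintype.card_fin]
    ring
  rw [hdet, Real.sqrt_mul (sq_nonneg _), Real.sqrt_sq (pow_nonneg ht m)]

/-- the Lagrangian energy of the Nambu–Goto Lagrangian
`L(X) = −T √(−det(Xᵀ G X))` satisfies
`E_L = (fderiv ℝ L X) X − L(X) = −(m − 1) T √(−det g)` whenever `det g < 0`, `g = Xᵀ G X`
(that is, `E_L = −p T √(−det g)` for an `m = p + 1` dimensional worldvolume). -/
theorem stmt6 (D m : ℕ) (hD : 1 ≤ D) (hm : 1 ≤ m)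
    (T : ℝ) (hT : 0 < T)
    (G : Matrix (Fin D) (Fin D) ℝ) (hGsymm : Gᵀ = G) (hGdet : IsUnit G.det)
    (L : Matrix (Fin D) (Fin m) ℝ → ℝ)
    (hLdef : L = fun X => -T * Real.sqrt (-(Xᵀ * G * X).det))
    (X : Matrix (Fin D) (Fin m) ℝ)
    (hdet : (Xᵀ * G * X).det < 0)
    (g : Matrix (Fin m) (Fin m) ℝ) (hg : g = Xᵀ * G * X) :
    fderiv ℝ L X X - L X = -((m : ℝ) - 1) * T * Real.sqrt (-g.det) := by
  subst hLdef hg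
  have hdiff : DifferentiableAt ℝ
      (fun X : Matrix (Fin D) (Fin m) ℝ => -T * √(-(Xᵀ * G * X).det)) X :=
    (((differentiable_det_transpose_mul_mul G) X).fun_neg.sqrt (neg_ne_zero.mpr hdet.ne)).const_mul
      (-T)
  have heuler : fderiv ℝ (fun X : Matrix (Fin D) (Fin m) ℝ => -T * √(-(Xᵀ * G * X).det)) X X =
      m * (-T * √(-(Xᵀ * G * X).det)) :=
    fderiv_apply_self_of_homogeneous m hdiff fun t ht => by
      rw [sqrt_neg_det_smul G X ht.le]
      ring
  rw [heuler]
  ring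
end

section
/- Let X be a real D × m matrix with det(Xᵀ * G * X) < 0, set g = Xᵀ * G * X, and define the multimomentum matrix P = (−T · Real.sqrt(−det g)) • (g⁻¹ * Xᵀ * G), an m × D real matrix (whose (a, μ) entry is p^a_μ = ∂L/∂x^μ_a). Then: (i) P * G⁻¹ * Pᵀ = (−T² · det g) • g⁻¹; and (ii) det(P * G⁻¹ * Pᵀ) = (−T²)^m · (det g)^(m−1). In particular, for the string (m = 2), writing Π = P * G⁻¹ * Pᵀ, one has Π^{ab} = −T² det g · g^{ba} and det Π = T⁴ det g. -/
open Matrix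

/-- for the Nambu–Goto `p`-brane multimomentum matrix
`P = (−T √(−det g)) • (g⁻¹ Xᵀ G)` (with `g = Xᵀ G X`, `det g < 0`), one has
(i) `P G⁻¹ Pᵀ = (−T² det g) • g⁻¹` and (ii) `det(P G⁻¹ Pᵀ) = (−T²)^m (det g)^(m−1)`. -/
theorem stmt7 (D m : ℕ) (hD : 1 ≤ D) (hm : 1 ≤ m)
    (T : ℝ) (hT : 0 < T)
    (G : Matrix (Fin D) (Fin D) ℝ) (hGsymm : Gᵀ = G) (hGdet : IsUnit G.det)
    (X : Matrix (Fin D) (Fin m) ℝ)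
    (hdet : (Xᵀ * G * X).det < 0)
    (g : Matrix (Fin m) (Fin m) ℝ) (hg : g = Xᵀ * G * X)
    (P : Matrix (Fin m) (Fin D) ℝ)
    (hP : P = (-T * Real.sqrt (-g.det)) • (g⁻¹ * Xᵀ * G)) :
    P * G⁻¹ * Pᵀ = (-(T ^ 2) * g.det) • g⁻¹ ∧
      (P * G⁻¹ * Pᵀ).det = (-(T ^ 2)) ^ m * g.det ^ (m - 1) := by
  have hneg : g.det < 0 := hg ▸ hdet
  have hunit : IsUnit g.det := hneg.ne.isUnit
  have hgsymm : gᵀ = g := by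
    rw [hg]
    simp only [transpose_mul, transpose_transpose, hGsymm, Matrix.mul_assoc]
  have hcontract : g⁻¹ * Xᵀ * G * G⁻¹ * (g⁻¹ * Xᵀ * G)ᵀ = g⁻¹ := by
    rw [mul_nonsing_inv_cancel_right _ _ hGdet]
    simp only [transpose_mul, transpose_transpose, transpose_nonsing_inv, hGsymm, hgsymm]
    calc g⁻¹ * Xᵀ * (G * (X * g⁻¹)) = g⁻¹ * (Xᵀ * G * X) * g⁻¹ := by
          simp only [Matrix.mul_assoc]
      _ = g⁻¹ := by rw [← hg, nonsing_inv_mul _ hunit, Matrix.one_mul]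
  have hscalar : (-T * √(-g.det)) * (-T * √(-g.det)) = -(T ^ 2) * g.det := by
    linear_combination T ^ 2 * Real.mul_self_sqrt (neg_nonneg.2 hneg.le)
  have hinv : P * G⁻¹ * Pᵀ = (-(T ^ 2) * g.det) • g⁻¹ := by
    rw [hP, transpose_smul, Matrix.smul_mul, Matrix.smul_mul, Matrix.mul_smul, smul_smul,
      hcontract, hscalar]
  refine ⟨hinv, ?_⟩
  obtain ⟨k, rfl⟩ := Nat.exists_eq_add_of_le' hm
  rw [hinv, det_smul, det_nonsing_inv, Ring.inverse_eq_inv', Fintype.card_fin, mul_pow,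
    Nat.add_sub_cancel, pow_succ g.det, mul_assoc, mul_assoc, mul_inv_cancel₀ hneg.ne, mul_one]
end

section
/- Take m = 2 (the bosonic string). Let X be a real D × 2 matrix with det(Xᵀ * G * X) < 0, set g = Xᵀ * G * X, P = (−T · Real.sqrt(−det g)) • (g⁻¹ * Xᵀ * G), and Π = P * G⁻¹ * Pᵀ. Then X = (−(1/T) · Real.sqrt(−det Π)) • (G⁻¹ * Pᵀ * Π⁻¹). Componentwise this is the paper's inverse Legendre map formula x^ν_b = −(1/T) √(−det Π) G^{μν} Π_{ab} p^a_μ, showing that the De Donder–Weyl Legendre map of the Nambu–Goto string is invertible (the Lagrangian is regular). -/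
open Matrix

/-- the bosonic string, `m = 2`: the De Donder–Weyl Legendre map of the
Nambu–Goto string is invertible; with `g = Xᵀ G X` (`det g < 0`),
`P = (−T √(−det g)) • (g⁻¹ Xᵀ G)` and `Π = P G⁻¹ Pᵀ`, one recovers
`X = (−(1/T) √(−det Π)) • (G⁻¹ Pᵀ Π⁻¹)`, i.e. the paper's inverse Legendre map formula
`x^ν_b = −(1/T) √(−det Π) G^{μν} Π_{ab} p^a_μ`. -/
theorem stmt8 (D : ℕ) (hD : 1 ≤ D)
    (T : ℝ) (hT : 0 < T)
    (G : Matrix (Fin D) (Fin D) ℝ) (hGsymm : Gᵀ = G) (hGdet : IsUnit G.det)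
    (X : Matrix (Fin D) (Fin 2) ℝ)
    (hdet : (Xᵀ * G * X).det < 0)
    (g : Matrix (Fin 2) (Fin 2) ℝ) (hg : g = Xᵀ * G * X)
    (P : Matrix (Fin 2) (Fin D) ℝ)
    (hP : P = (-T * Real.sqrt (-g.det)) • (g⁻¹ * Xᵀ * G))
    (Pi2 : Matrix (Fin 2) (Fin 2) ℝ) (hPi2 : Pi2 = P * G⁻¹ * Pᵀ) :
    X = (-(1 / T) * Real.sqrt (-Pi2.det)) • (G⁻¹ * Pᵀ * Pi2⁻¹) := by
  have hg_det : g.det < 0 := hg ▸ hdet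
  have hg_unit : IsUnit g.det := hg_det.ne.isUnit
  have hg_symm : gᵀ = g := by
    rw [hg]
    simp [Matrix.transpose_mul, hGsymm, Matrix.mul_assoc]
  have hs_sq : Real.sqrt (-g.det) ^ 2 = -g.det := Real.sq_sqrt (by linarith)
  have hs_pos : 0 < Real.sqrt (-g.det) := Real.sqrt_pos.mpr (by linarith)
  set s := Real.sqrt (-g.det)
  have hc : -T * s ≠ 0 := mul_ne_zero (neg_ne_zero.mpr hT.ne') hs_pos.ne'
  have hGP : G⁻¹ * Pᵀ = (-T * s) • (X * g⁻¹) := by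
    rw [hP, Matrix.transpose_smul, Matrix.transpose_mul, Matrix.transpose_mul,
      Matrix.transpose_transpose, Matrix.transpose_nonsing_inv, hg_symm, hGsymm,
      Matrix.mul_smul, Matrix.nonsing_inv_mul_cancel_left _ _ hGdet]
  have hPi : Pi2 = (-T * s) ^ 2 • g⁻¹ := by
    rw [hPi2, Matrix.mul_assoc, hGP, hP, Matrix.smul_mul, Matrix.mul_smul, smul_smul, ← sq]
    congr 1
    calc g⁻¹ * Xᵀ * G * (X * g⁻¹) = g⁻¹ * (Xᵀ * G * X) * g⁻¹ := by
          simp only [Matrix.mul_assoc]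
      _ = g⁻¹ := by rw [← hg, Matrix.nonsing_inv_mul _ hg_unit, Matrix.one_mul]
  have hPi_inv : Pi2⁻¹ = ((-T * s) ^ 2)⁻¹ • g := by
    refine Matrix.inv_eq_right_inv ?_
    rw [hPi, Matrix.smul_mul, Matrix.mul_smul, smul_smul, Matrix.nonsing_inv_mul _ hg_unit,
      mul_inv_cancel₀ (pow_ne_zero 2 hc), one_smul]
  have hPi_det : -Pi2.det = (T ^ 2 * s) ^ 2 := by
    rw [hPi, Matrix.det_smul, Matrix.det_nonsing_inv, Ring.inverse_eq_inv', Fintype.card_fin,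
      mul_pow (-T) s 2, mul_pow (T ^ 2) s 2, hs_sq]
    field_simp [hg_det.ne]
  have hPi_sqrt : Real.sqrt (-Pi2.det) = T ^ 2 * s := by
    rw [hPi_det, Real.sqrt_sq (by positivity)]
  rw [hPi_sqrt, hGP, hPi_inv, Matrix.smul_mul, Matrix.mul_smul, smul_smul, smul_smul,
    Matrix.nonsing_inv_mul_cancel_right _ _ hg_unit]
  have hcoeff : -(1 / T) * (T ^ 2 * s) * (-T * s) * ((-T * s) ^ 2)⁻¹ = 1 := by
    field_simp
  rw [hcoeff, one_smul]
end

section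
/- Take m = 2 (the bosonic string). Let X be a real D × 2 matrix with det(Xᵀ * G * X) < 0, set g = Xᵀ * G * X, P = (−T · Real.sqrt(−det g)) • (g⁻¹ * Xᵀ * G), and Π = P * G⁻¹ * Pᵀ. Then −(1/T) · Real.sqrt(−det Π) = −T · Real.sqrt(−det g). That is, the pullback under the De Donder–Weyl Legendre map of the string De Donder–Weyl Hamiltonian H = −(1/T)√(−det Π) equals the Lagrangian energy E_L = −T√(−det g). -/
open Matrix

/-- the bosonic string, `m = 2`: the pullback under the De Donder–Weyl
Legendre map of the string De Donder–Weyl Hamiltonian `H = −(1/T)√(−det Π)` equals the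
Lagrangian energy `E_L = −T√(−det g)`, where `g = Xᵀ G X` (`det g < 0`),
`P = (−T √(−det g)) • (g⁻¹ Xᵀ G)` and `Π = P G⁻¹ Pᵀ`. -/
theorem stmt9 (D : ℕ) (hD : 1 ≤ D)
    (T : ℝ) (hT : 0 < T)
    (G : Matrix (Fin D) (Fin D) ℝ) (hGsymm : Gᵀ = G) (hGdet : IsUnit G.det)
    (X : Matrix (Fin D) (Fin 2) ℝ)
    (hdet : (Xᵀ * G * X).det < 0)
    (g : Matrix (Fin 2) (Fin 2) ℝ) (hg : g = Xᵀ * G * X)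
    (P : Matrix (Fin 2) (Fin D) ℝ)
    (hP : P = (-T * Real.sqrt (-g.det)) • (g⁻¹ * Xᵀ * G))
    (Pi2 : Matrix (Fin 2) (Fin 2) ℝ) (hPi2 : Pi2 = P * G⁻¹ * Pᵀ) :
    -(1 / T) * Real.sqrt (-Pi2.det) = -T * Real.sqrt (-g.det) := by
  rw [← hg] at hdet
  have hgne : g.det ≠ 0 := hdet.ne
  have hsq : Real.sqrt (-g.det) ^ 2 = -g.det := Real.sq_sqrt (by linarith)
  have hPi : Pi2 = ((-T * Real.sqrt (-g.det)) ^ 2) • (g⁻¹ * g * g⁻¹ᵀ) := by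
    have hcancel : g⁻¹ * Xᵀ * G * G⁻¹ = g⁻¹ * Xᵀ := Matrix.mul_nonsing_inv_cancel_right G _ hGdet
    have htranspose : (g⁻¹ * Xᵀ * G)ᵀ = G * X * g⁻¹ᵀ := by
      simp only [Matrix.transpose_mul, Matrix.transpose_transpose, hGsymm, Matrix.mul_assoc]
    have hgram : g⁻¹ * Xᵀ * (G * X * g⁻¹ᵀ) = g⁻¹ * g * g⁻¹ᵀ := by
      conv_rhs => rw [Matrix.mul_assoc, show g * g⁻¹ᵀ = Xᵀ * G * X * g⁻¹ᵀ by rw [← hg]]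
      simp only [Matrix.mul_assoc]
    rw [hPi2, hP, Matrix.transpose_smul, Matrix.smul_mul, Matrix.smul_mul, Matrix.mul_smul,
      smul_smul, hcancel, htranspose, hgram, sq]
  have hdetPi : -Pi2.det = (T ^ 2) ^ 2 * -g.det := by
    rw [hPi, Matrix.det_smul, Matrix.det_mul, Matrix.det_mul, Matrix.det_transpose,
      Matrix.det_nonsing_inv, Ring.inverse_eq_inv', mul_pow, hsq, Fintype.card_fin]
    field_simp
  rw [hdetPi, Real.sqrt_mul (by positivity), Real.sqrt_sq (by positivity)]
  field_simp
end

section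
/- Define H : Matrix (Fin 2) (Fin D) ℝ → ℝ by H(P) = −(1/T) · Real.sqrt(−det(P * G⁻¹ * Pᵀ)) (the De Donder–Weyl Hamiltonian of the Nambu–Goto string). Let P be a real 2 × D matrix with det(P * G⁻¹ * Pᵀ) < 0 and set Π = P * G⁻¹ * Pᵀ. Then H is Fréchet differentiable at P and for every real 2 × D matrix K: (fderiv ℝ H P) K = −(1/T) · Real.sqrt(−det Π) · Matrix.trace(Π⁻¹ * P * G⁻¹ * Kᵀ). Componentwise, ∂H/∂p^a_μ = −(1/T) √(−det Π) Π_{ba} G^{μν} p^b_ν, which is (minus) the right-hand side appearing in the Hamilton–De Donder–Weyl equations ∂x^μ/∂σ^a = ∂H/∂p^a_μ for the bosonic string. -/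
open Matrix

attribute [local instance] Matrix.normedAddCommGroup Matrix.normedSpace

/-- Differentiability of `P ↦ det (P A Pᵀ)` for two-row matrices. -/
lemma differentiable_det_mul_mul_transpose {n : Type*} [Fintype n] (A : Matrix n n ℝ) :
    Differentiable ℝ fun P : Matrix (Fin 2) n ℝ => (P * A * Pᵀ).det := by
  have hentry (i : Fin 2) (j : n) : Differentiable ℝ fun P : Matrix (Fin 2) n ℝ => P i j :=
    (Matrix.entryLinearMap ℝ ℝ i j).toContinuousLinearMap.differentiable
  simp only [Matrix.det_fin_two, Matrix.mul_apply, Matrix.transpose_apply]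
  fun_prop

/-- Jacobi's formula for `P ↦ det (P A Pᵀ)` with `A` symmetric, along a line. -/
lemma hasDerivAt_det_mul_mul_transpose {n : Type*} [Fintype n] {A : Matrix n n ℝ}
    (hA : A.IsSymm) (P K : Matrix (Fin 2) n ℝ) (hP : (P * A * Pᵀ).det ≠ 0) :
    HasDerivAt (fun t : ℝ => ((P + t • K) * A * (P + t • K)ᵀ).det)
      (2 * (P * A * Pᵀ).det * ((P * A * Pᵀ)⁻¹ * (P * A * Kᵀ)).trace) 0 := by
  have hexpand (t : ℝ) : (P + t • K) * A * (P + t • K)ᵀ =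
      P * A * Pᵀ + t • (P * A * Kᵀ + (P * A * Kᵀ)ᵀ) + t ^ 2 • (K * A * Kᵀ) := by
    simp only [Matrix.transpose_add, Matrix.transpose_smul, Matrix.transpose_mul,
      Matrix.transpose_transpose, hA.eq, Matrix.add_mul, Matrix.mul_add, Matrix.smul_mul,
      Matrix.mul_smul, smul_add, smul_smul, pow_two, Matrix.mul_assoc]
    abel
  have hsymm : (P * A * Pᵀ) 1 0 = (P * A * Pᵀ) 0 1 := by
    have h : (P * A * Pᵀ)ᵀ = P * A * Pᵀ := by
      simp [Matrix.transpose_mul, hA.eq, Matrix.mul_assoc]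
    exact congrFun (congrFun h 0) 1
  simp only [hexpand]
  generalize P * A * Pᵀ = M at *
  generalize P * A * Kᵀ = S at *
  generalize K * A * Kᵀ = N at *
  have htrace : M.det * (M⁻¹ * S).trace = (M.adjugate * S).trace := by
    rw [Matrix.inv_def, Ring.inverse_eq_inv', Matrix.smul_mul, Matrix.trace_smul, smul_eq_mul,
      mul_inv_cancel_left₀ hP]
  have hlin (i j : Fin 2) : HasDerivAt
      (fun t : ℝ => M i j + t * (S i j + S j i) + t ^ 2 * N i j) (S i j + S j i) 0 := by
    have h := (((hasDerivAt_id (0 : ℝ)).mul_const (S i j + S j i)).const_add (M i j)).add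
      (((hasDerivAt_id (0 : ℝ)).pow 2).mul_const (N i j))
    exact HasDerivAt.congr_deriv h (by simp)
  rw [mul_assoc, htrace]
  simp only [Matrix.det_fin_two, Matrix.add_apply, Matrix.smul_apply, Matrix.transpose_apply,
    smul_eq_mul]
  refine HasDerivAt.congr_deriv
    (((hlin 0 0).mul (hlin 1 1)).sub ((hlin 0 1).mul (hlin 1 0))) ?_
  rw [Matrix.trace_fin_two, Matrix.mul_apply, Matrix.mul_apply]
  simp [Matrix.adjugate_fin_two, Fin.sum_univ_two, hsymm]
  ring

/-- Fréchet derivative of the De Donder–Weyl Hamiltonian of the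
Nambu–Goto string, `H(P) = −(1/T)√(−det(P G⁻¹ Pᵀ))`: at any `P` with
`det(P G⁻¹ Pᵀ) < 0`, `H` is differentiable and
`(fderiv ℝ H P) K = −(1/T) √(−det Π) · trace(Π⁻¹ P G⁻¹ Kᵀ)` with `Π = P G⁻¹ Pᵀ`;
componentwise `∂H/∂p^a_μ = −(1/T)√(−det Π) Π_{ba} G^{μν} p^b_ν`. -/
theorem stmt10 (D : ℕ) (hD : 1 ≤ D)
    (T : ℝ) (hT : 0 < T)
    (G : Matrix (Fin D) (Fin D) ℝ) (hGsymm : Gᵀ = G) (hGdet : IsUnit G.det)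
    (H : Matrix (Fin 2) (Fin D) ℝ → ℝ)
    (hHdef : H = fun P => -(1 / T) * Real.sqrt (-(P * G⁻¹ * Pᵀ).det))
    (P : Matrix (Fin 2) (Fin D) ℝ)
    (hdet : (P * G⁻¹ * Pᵀ).det < 0)
    (Pi2 : Matrix (Fin 2) (Fin 2) ℝ) (hPi2 : Pi2 = P * G⁻¹ * Pᵀ) :
    DifferentiableAt ℝ H P ∧
      ∀ K : Matrix (Fin 2) (Fin D) ℝ,
        fderiv ℝ H P K = -(1 / T) * Real.sqrt (-Pi2.det) * (Pi2⁻¹ * P * G⁻¹ * Kᵀ).trace := by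
  have hA : (G⁻¹).IsSymm := by
    rw [Matrix.IsSymm, Matrix.transpose_nonsing_inv, hGsymm]
  have hH : DifferentiableAt ℝ H P := by
    rw [hHdef]
    exact (((differentiable_det_mul_mul_transpose G⁻¹ P).neg).sqrt
      (neg_ne_zero.mpr hdet.ne)).const_mul _
  refine ⟨hH, fun K => ?_⟩
  refine (hH.lineDeriv_eq_fderiv (v := K)).symm.trans ?_
  have hpos : 0 < -(P * G⁻¹ * Pᵀ).det := neg_pos.mpr hdet
  have hderiv := ((hasDerivAt_det_mul_mul_transpose hA P K hdet.ne).neg.sqrt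
    (by simpa using hdet.ne)).const_mul (-(1 / T))
  rw [hHdef]
  refine hderiv.deriv.trans ?_
  rw [hPi2]
  simp only [Pi.neg_apply, zero_smul, add_zero, Matrix.mul_assoc] at hpos ⊢
  have hsqrt := Real.sq_sqrt hpos.le
  have hne := (Real.sqrt_pos.mpr hpos).ne'
  field_simp
  rw [hsqrt]
  ring
end

section
/- Let Dc : Fin 2 → Fin D → ℝ and Hc : Fin 2 → Fin 2 → Fin D → ℝ (the components D^μ_a and H^a_{kμ} of a multivector field on the string multimomentum phase space). Assume: (a) for every μ, Σ_a Hc a a μ − (s/(2T)) Σ_{a,b,ρ,σ} Πinv b a · (Γ μ) ρ σ · (p a ρ) · (p b σ) = 0; and (b) for all a and μ, Dc a μ + (s/T) Σ_{b,ν} Πinv b a · (Ginv μ ν) · (p b ν) = 0. Then for every k : Fin 2: Σ_{a,μ} (Dc a μ) · (Hc a k μ) − Σ_μ (Dc k μ) · (Σ_a Hc a a μ) + (s/T) Σ_{a,b} Πinv b a · [ (1/2) Σ_{μ,ρ,σ} (Dc k μ) · (Γ μ) ρ σ · (p a ρ) · (p b σ) + Σ_{μ,ν} (Hc a k μ) ·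 (Ginv μ ν) · (p b ν) ] = 0. That is, the third of the Hamilton–De Donder–Weyl field equations for the Nambu–Goto string is an identity given the first two. -/
open Matrix

/-- The third field equation is the combination of the first two with coefficients `-Dc k μ` and
`Hc a k μ`. Here `Q μ a b` and `V b μ` stand for the contractions `∂_μ G^{ρσ} p^a_ρ p^b_σ` and
`G^{μν} p^b_ν`. -/
theorem third_equation_of_contracted {ι : Type*} [Fintype ι] (T s : ℝ)
    (P : Matrix (Fin 2) (Fin 2) ℝ) (Q : ι → Fin 2 → Fin 2 → ℝ) (V : Fin 2 → ι → ℝ)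
    (Dc : Fin 2 → ι → ℝ) (Hc : Fin 2 → Fin 2 → ι → ℝ)
    (heqa : ∀ μ, (∑ a, Hc a a μ) - (s / (2 * T)) * ∑ a, ∑ b, P b a * Q μ a b = 0)
    (heqb : ∀ a μ, Dc a μ + (s / T) * ∑ b, P b a * V b μ = 0) (k : Fin 2) :
    (∑ a, ∑ μ, Dc a μ * Hc a k μ) - (∑ μ, Dc k μ * ∑ a, Hc a a μ) +
      (s / T) * ∑ a, ∑ b, P b a *
        ((1 / 2) * (∑ μ, Dc k μ * Q μ a b) + ∑ μ, Hc a k μ * V b μ) = 0 := by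
  simp only [Fin.sum_univ_two] at heqa heqb ⊢
  simp only [Finset.mul_sum, ← Finset.sum_add_distrib, ← Finset.sum_sub_distrib]
  refine Finset.sum_eq_zero fun μ _ => ?_
  linear_combination Hc 0 k μ * heqb 0 μ + Hc 1 k μ * heqb 1 μ - Dc k μ * heqa μ

/-- paper's equations (76a)–(76c), pointwise algebraic form: given the
first two Hamilton–De Donder–Weyl field equations for the Nambu–Goto string, the third
one is an identity. Here `Ginv` are the components `G^{μν}` of the inverse spacetime
metric at a point, `Γ μ` the components `∂_μ G^{ρσ}`, `p` the string multimomenta,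
`Π^{ab} = G^{μν} p^a_μ p^b_ν`, `Πinv = Π⁻¹` and `s = √(−det Π)`. -/
theorem stmt11 (D : ℕ) (hD : 1 ≤ D)
    (T : ℝ) (hT : 0 < T)
    (Ginv : Matrix (Fin D) (Fin D) ℝ) (hGsymm : Ginvᵀ = Ginv) (hGdet : IsUnit Ginv.det)
    (Γ : Fin D → Matrix (Fin D) (Fin D) ℝ) (hΓsymm : ∀ μ, (Γ μ)ᵀ = Γ μ)
    (p : Fin 2 → Fin D → ℝ)
    (PiM : Matrix (Fin 2) (Fin 2) ℝ)
    (hPiM : PiM = Matrix.of fun a b => ∑ μ : Fin D, ∑ ν : Fin D, Ginv μ ν * p a μ * p b ν)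
    (hdet : PiM.det < 0)
    (Piinv : Matrix (Fin 2) (Fin 2) ℝ) (hPiinv : Piinv = PiM⁻¹)
    (s : ℝ) (hs : s = Real.sqrt (-PiM.det))
    (Dc : Fin 2 → Fin D → ℝ)
    (Hc : Fin 2 → Fin 2 → Fin D → ℝ)
    (heqa : ∀ μ : Fin D,
      (∑ a : Fin 2, Hc a a μ) -
        (s / (2 * T)) * ∑ a : Fin 2, ∑ b : Fin 2, ∑ ρ : Fin D, ∑ σ : Fin D,
          Piinv b a * Γ μ ρ σ * p a ρ * p b σ = 0)
    (heqb : ∀ (a : Fin 2) (μ : Fin D),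
      Dc a μ + (s / T) * ∑ b : Fin 2, ∑ ν : Fin D, Piinv b a * Ginv μ ν * p b ν = 0) :
    ∀ k : Fin 2,
      (∑ a : Fin 2, ∑ μ : Fin D, Dc a μ * Hc a k μ) -
        (∑ μ : Fin D, Dc k μ * ∑ a : Fin 2, Hc a a μ) +
        (s / T) * ∑ a : Fin 2, ∑ b : Fin 2, Piinv b a *
          ((1 / 2) * (∑ μ : Fin D, ∑ ρ : Fin D, ∑ σ : Fin D,
              Dc k μ * Γ μ ρ σ * p a ρ * p b σ) +
            ∑ μ : Fin D, ∑ ν : Fin D, Hc a k μ * Ginv μ ν * p b ν) = 0 := by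
  intro k
  simp only [mul_assoc, ← Finset.mul_sum] at heqa heqb ⊢
  exact third_equation_of_contracted T s Piinv
    (fun μ a b => ∑ ρ, ∑ σ, Γ μ ρ σ * (p a ρ * p b σ)) (fun b μ => ∑ ν, Ginv μ ν * p b ν)
    Dc Hc heqa heqb k
end

section
/- For the canonical Klein–Gordon multivelocity phase space, the common kernel {Z ∈ V : (for all v₁,…,v_{m+1} ∈ V, Ω̃(Z, v₁, …, v_m) = 0 as an (m+1)-form, i.e., Ω̃ vanishes whenever Z is one of its arguments) and (ω(Z, v₁, …, v_{m−1}) = 0 for all v₁,…,v_{m−1} ∈ V)} equals the set of Z = (a, b, c, u, w) with a = 0, b = 0, c = 0, and u i = 0 for every i ≠ 0 (with u 0 and all of w arbitrary). That is, ker Ω̃ ∩ ker ω is the span of the ∂/∂φ₀ direction together with all ∂/∂π_μ directions. -/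
namespace Stmt12

/-- The multivelocity phase space directions `(x^μ, φ, π, φ_μ, π_μ)`, `m = k + 1`. -/
abbrev V (m : ℕ) : Type := (Fin m → ℝ) × ℝ × ℝ × (Fin m → ℝ) × (Fin m → ℝ)

/-- The coordinate 1-form `dx^μ`. -/
def dx (m : ℕ) (μ : Fin m) : V m →ₗ[ℝ] ℝ where
  toFun Z := Z.1 μ
  map_add' _ _ := rfl
  map_smul' _ _ := rfl

/-- The coordinate 1-form `dφ`. -/
def dphi (m : ℕ) : V m →ₗ[ℝ] ℝ where
  toFun Z := Z.2.1
  map_add' _ _ := rfl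
  map_smul' _ _ := rfl

/-- The coordinate 1-form `dπ`. -/
def dpi (m : ℕ) : V m →ₗ[ℝ] ℝ where
  toFun Z := Z.2.2.1
  map_add' _ _ := rfl
  map_smul' _ _ := rfl

/-- The coordinate 1-form `dφ_μ`. -/
def dphiv (m : ℕ) (μ : Fin m) : V m →ₗ[ℝ] ℝ where
  toFun Z := Z.2.2.2.1 μ
  map_add' _ _ := rfl
  map_smul' _ _ := rfl

/-- The coordinate 1-form `dπ_μ`. -/
def dpiv (m : ℕ) (μ : Fin m) : V m →ₗ[ℝ] ℝ where
  toFun Z := Z.2.2.2.2 μ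
  map_add' _ _ := rfl
  map_smul' _ _ := rfl

/-- The wedge `λ₁ ∧ … ∧ λ_k` of linear functionals, evaluated on vectors:
the determinant of the matrix with `(i,j)` entry `λ_i(v_j)`. -/
noncomputable def wedge {m k : ℕ} (lam : Fin k → (V m →ₗ[ℝ] ℝ)) (v : Fin k → V m) : ℝ :=
  (Matrix.of fun i j => lam i (v j)).det

/-- The standard basis vector in the `x^μ` direction. -/
noncomputable def ex (m : ℕ) (μ : Fin m) : V m := (Pi.single μ 1, 0, 0, 0, 0)

/-- The volume form `ω = dx⁰ ∧ … ∧ dx^{m−1}`. -/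
noncomputable def vol (m : ℕ) (v : Fin m → V m) : ℝ := wedge (fun μ => dx m μ) v

/-- The `(m+2)`-form `Δ₀ = dφ ∧ dπ ∧ dx⁰ ∧ … ∧ dx^{m−1}` (`m = k+1`). -/
noncomputable def Delta0 (k : ℕ) : (Fin (k + 3) → V (k + 1)) → ℝ :=
  wedge (Fin.cons (dphi (k + 1)) (Fin.cons (dpi (k + 1)) (fun μ : Fin (k + 1) => dx (k + 1) μ)))

/-- The `(m+2)`-form `Δ_i = dφ_i ∧ dφ ∧ dx⁰ ∧ … ∧ dx^{m−1}` (`m = k+1`). -/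
noncomputable def DeltaI (k : ℕ) (i : Fin (k + 1)) : (Fin (k + 3) → V (k + 1)) → ℝ :=
  wedge (Fin.cons (dphiv (k + 1) i) (Fin.cons (dphi (k + 1)) (fun μ : Fin (k + 1) => dx (k + 1) μ)))

/-- `Ω̃ = dφ ∧ dπ ∧ d^{m−1}x₀ − ∑_{i=1}^{m−1} dφ_i ∧ dφ ∧ d^{m−1}x_i`, i.e.
`Ω̃(v₁,…,v_{m+1}) = Δ₀(e^x_0, v₁,…,v_{m+1}) − ∑_i Δ_i(e^x_i, v₁,…,v_{m+1})` (`m = k+1`). -/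
noncomputable def OmegaTilde (k : ℕ) (v : Fin (k + 2) → V (k + 1)) : ℝ :=
  Delta0 k (Fin.cons (ex (k + 1) 0) v)
    - ∑ i : Fin k, DeltaI k i.succ (Fin.cons (ex (k + 1) i.succ) v)

theorem wedge_eq_zero_of_eq {m k : ℕ} (lam : Fin k → (V m →ₗ[ℝ] ℝ)) {v : Fin k → V m}
    {i j : Fin k} (hij : i ≠ j) (h : v i = v j) : wedge lam v = 0 :=
  Matrix.det_zero_of_column_eq hij fun l => by simp [h]

theorem wedge_eq_zero_of_forall_apply_eq_zero {m k : ℕ} {lam : Fin k → (V m →ₗ[ℝ] ℝ)}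
    {v : Fin k → V m} (j : Fin k) (h : ∀ i, lam i (v j) = 0) : wedge lam v = 0 :=
  Matrix.det_eq_zero_of_column_eq_zero j h

/-- If a wedge of functionals vanishes on `v`, then some nontrivial linear combination of the
functionals vanishes on every `v j`. -/
theorem exists_ne_zero_of_wedge_eq_zero {m k : ℕ} {lam : Fin k → (V m →ₗ[ℝ] ℝ)}
    {v : Fin k → V m} (h : wedge lam v = 0) :
    ∃ r : Fin k → ℝ, r ≠ 0 ∧ ∀ j, ∑ i, r i * lam i (v j) = 0 := by
  obtain ⟨r, hr, hrv⟩ := Matrix.exists_vecMul_eq_zero_iff.mpr h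
  exact ⟨r, hr, fun j => congrFun hrv j⟩

theorem sum_mul_dx_ex {m : ℕ} (r : Fin m → ℝ) (ν : Fin m) :
    ∑ μ, r μ * dx m μ (ex m ν) = r ν := by
  simp [dx, ex, Pi.single_apply]

/-- The vectors `Z`, `Y` and all `e^x_ν` with `ν ≠ μ`. -/
noncomputable def frame {k : ℕ} (μ : Fin (k + 1)) (Z Y : V (k + 1)) : Fin (k + 2) → V (k + 1) :=
  Fin.cons Z (Fin.cons Y fun j => ex (k + 1) (μ.succAbove j))

theorem wedge_frame_eq_zero_of_ne {k : ℕ} (lam : Fin (k + 3) → (V (k + 1) →ₗ[ℝ] ℝ))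
    {μ ν : Fin (k + 1)} (h : ν ≠ μ) (Z Y : V (k + 1)) :
    wedge lam (Fin.cons (ex (k + 1) ν) (frame μ Z Y)) = 0 := by
  obtain ⟨j, rfl⟩ := Fin.exists_succAbove_eq h
  exact wedge_eq_zero_of_eq lam (i := 0) (j := j.succ.succ.succ) (Fin.succ_ne_zero _).symm
    (by simp [frame])

theorem mul_eq_mul_of_wedge_frame_eq_zero {k : ℕ} {α β : V (k + 1) →ₗ[ℝ] ℝ}
    (hα : ∀ ν, α (ex (k + 1) ν) = 0) (hβ : ∀ ν, β (ex (k + 1) ν) = 0)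
    (μ : Fin (k + 1)) {Z Y : V (k + 1)}
    (h : wedge (Fin.cons α (Fin.cons β fun ν => dx (k + 1) ν))
      (Fin.cons (ex (k + 1) μ) (frame μ Z Y)) = 0) :
    α Z * β Y = α Y * β Z := by
  obtain ⟨r, hr, hrv⟩ := exists_ne_zero_of_wedge_eq_zero h
  simp only [Fin.sum_univ_succ (n := k + 2), Fin.sum_univ_succ (n := k + 1), Fin.cons_zero,
    Fin.cons_succ] at hrv
  have hx : ∀ ν : Fin (k + 1), r ν.succ.succ = 0 := by
    intro ν
    have hν := sum_mul_dx_ex (fun ν => r ν.succ.succ) ν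
    by_cases hνμ : ν = μ
    · subst hνμ
      have h0 := hrv 0
      simp only [Fin.cons_zero, hα, hβ, mul_zero, zero_add] at h0
      exact hν.symm.trans h0
    · obtain ⟨j, rfl⟩ := Fin.exists_succAbove_eq hνμ
      have hj := hrv j.succ.succ.succ
      simp only [frame, Fin.cons_succ, hα, hβ, mul_zero, zero_add] at hj
      exact hν.symm.trans hj
  have hZ := hrv (Fin.succ 0)
  have hY := hrv (Fin.succ (Fin.succ 0))
  simp only [frame, Fin.cons_succ, Fin.cons_zero, hx, zero_mul, Finset.sum_const_zero,
    add_zero] at hZ hY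
  by_contra hne
  have hne' := sub_ne_zero.mpr hne
  have h0 : r 0 = 0 := (mul_eq_zero.mp (by linear_combination β Y * hZ - β Z * hY :
    r 0 * (α Z * β Y - α Y * β Z) = 0)).resolve_right hne'
  have h1 : r (Fin.succ 0) = 0 := (mul_eq_zero.mp (by linear_combination α Z * hY - α Y * hZ :
    r (Fin.succ 0) * (α Z * β Y - α Y * β Z) = 0)).resolve_right hne'
  exact hr (funext (Fin.cases h0 (Fin.cases h1 hx)))

theorem OmegaTilde_frame_zero {k : ℕ} (Z Y : V (k + 1)) :
    OmegaTilde k (frame 0 Z Y) = Delta0 k (Fin.cons (ex (k + 1) 0) (frame 0 Z Y)) := by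
  rw [OmegaTilde, Finset.sum_eq_zero, sub_zero]
  exact fun i _ => wedge_frame_eq_zero_of_ne _ (Fin.succ_ne_zero i) Z Y

theorem OmegaTilde_frame_succ {k : ℕ} (i : Fin k) (Z Y : V (k + 1)) :
    OmegaTilde k (frame i.succ Z Y) =
      -DeltaI k i.succ (Fin.cons (ex (k + 1) i.succ) (frame i.succ Z Y)) := by
  rw [OmegaTilde, Finset.sum_eq_single i, Delta0,
    wedge_frame_eq_zero_of_ne _ (Fin.succ_ne_zero i).symm, zero_sub]
  · exact fun j _ hj => wedge_frame_eq_zero_of_ne _ (by simpa using hj) Z Y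
  · simp

theorem fst_eq_zero_of_vol_cons_eq_zero {k : ℕ} {Z : V (k + 1)}
    (h : ∀ w : Fin k → V (k + 1), vol (k + 1) (Fin.cons Z w) = 0) : Z.1 = 0 := by
  funext μ
  by_contra hμ
  obtain ⟨r, hr, hrv⟩ :=
    exists_ne_zero_of_wedge_eq_zero (h fun j => ex (k + 1) (μ.succAbove j))
  have hx : ∀ ν, ν ≠ μ → r ν = 0 := by
    intro ν hν
    obtain ⟨j, rfl⟩ := Fin.exists_succAbove_eq hν
    exact (sum_mul_dx_ex r _).symm.trans (by simpa only [Fin.cons_succ] using hrv j.succ)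
  have hZ := hrv 0
  rw [Finset.sum_eq_single μ (fun ν _ hν => by rw [hx ν hν, zero_mul]) (by simp)] at hZ
  refine hr (funext fun ν => ?_)
  by_cases hν : ν = μ
  · rw [hν]
    exact (mul_eq_zero.mp hZ).resolve_right hμ
  · exact hx ν hν

/-- for the canonical Klein–Gordon multivelocity phase space,
`ker Ω̃ ∩ ker ω` is exactly the span of the `∂/∂φ₀` direction together with all
`∂/∂π_μ` directions: it consists of the `Z = (a,b,c,u,w)` with `a = 0`, `b = 0`,
`c = 0`, and `u i = 0` for every `i ≠ 0` (with `u 0` and all of `w` arbitrary). -/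
theorem stmt12 (k : ℕ) :
    ∀ Z : V (k + 1),
      ((∀ v : Fin (k + 2) → V (k + 1), (∃ j, v j = Z) → OmegaTilde k v = 0) ∧
        (∀ w : Fin k → V (k + 1), vol (k + 1) (Fin.cons Z w) = 0))
      ↔ (Z.1 = 0 ∧ Z.2.1 = 0 ∧ Z.2.2.1 = 0 ∧
          ∀ i : Fin (k + 1), i ≠ 0 → Z.2.2.2.1 i = 0) := by
  intro Z
  constructor
  · rintro ⟨hΩ, hω⟩
    have hframe (μ : Fin (k + 1)) (Y : V (k + 1)) : OmegaTilde k (frame μ Z Y) = 0 :=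
      hΩ _ ⟨0, rfl⟩
    have hzero (Y : V (k + 1)) :
        dphi (k + 1) Z * dpi (k + 1) Y = dphi (k + 1) Y * dpi (k + 1) Z :=
      mul_eq_mul_of_wedge_frame_eq_zero (fun _ => rfl) (fun _ => rfl) 0
        ((OmegaTilde_frame_zero Z Y).symm.trans (hframe 0 Y))
    refine ⟨fst_eq_zero_of_vol_cons_eq_zero hω, ?_, ?_, ?_⟩
    · simpa [dphi, dpi] using hzero (0, 0, 1, 0, 0)
    · simpa [dphi, dpi] using (hzero (0, 1, 0, 0, 0)).symm
    · refine Fin.cases (fun h => absurd rfl h) fun i _ => ?_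
      have hi := mul_eq_mul_of_wedge_frame_eq_zero (α := dphiv (k + 1) i.succ)
        (β := dphi (k + 1)) (fun _ => rfl) (fun _ => rfl) i.succ
        (neg_eq_zero.mp ((OmegaTilde_frame_succ i Z (0, 1, 0, 0, 0)).symm.trans (hframe _ _)))
      simpa [dphi, dphiv] using hi
  · rintro ⟨ha, hb, hc, hu⟩
    have hdx (μ : Fin (k + 1)) : dx (k + 1) μ Z = 0 := congrFun ha μ
    refine ⟨?_, fun w => wedge_eq_zero_of_forall_apply_eq_zero 0 hdx⟩
    rintro v ⟨j, rfl⟩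
    have h0 : Delta0 k (Fin.cons (ex (k + 1) 0) v) = 0 :=
      wedge_eq_zero_of_forall_apply_eq_zero j.succ (Fin.cases hb (Fin.cases hc hdx))
    have hI (i : Fin k) : DeltaI k i.succ (Fin.cons (ex (k + 1) i.succ) v) = 0 :=
      wedge_eq_zero_of_forall_apply_eq_zero j.succ
        (Fin.cases (hu _ (Fin.succ_ne_zero i)) (Fin.cases hb hdx))
    simp [OmegaTilde, h0, hI]

end Stmt12
end

section
/- For the canonical Klein–Gordon multimomentum phase space, the common kernel {Z ∈ W : (Ω̃_H vanishes whenever Z is one of its m+1 arguments) and (ω(Z, v₁, …, v_{m−1}) = 0 for all v₁,…,v_{m−1} ∈ W)} equals {0}. That is, ker Ω̃_H ∩ ker ω = {0}, so by the compatibility criterion no compatibility constraints arise in the Hamiltonian formulation of the Klein–Gordon theory. -/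
namespace Stmt13

/-- The multimomentum phase space directions `(x^μ, φ, π, p^i_φ)`, `m = k + 1`
(the spatial index `i : Fin k` corresponds to the spacetime direction `i + 1`). -/
abbrev W (k : ℕ) : Type := (Fin (k + 1) → ℝ) × ℝ × ℝ × (Fin k → ℝ)

/-- The coordinate 1-form `dx^μ`. -/
def dx (k : ℕ) (μ : Fin (k + 1)) : W k →ₗ[ℝ] ℝ where
  toFun Z := Z.1 μ
  map_add' _ _ := rfl
  map_smul' _ _ := rfl

/-- The coordinate 1-form `dφ`. -/
def dphi (k : ℕ) : W k →ₗ[ℝ] ℝ where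
  toFun Z := Z.2.1
  map_add' _ _ := rfl
  map_smul' _ _ := rfl

/-- The coordinate 1-form `dπ`. -/
def dpi (k : ℕ) : W k →ₗ[ℝ] ℝ where
  toFun Z := Z.2.2.1
  map_add' _ _ := rfl
  map_smul' _ _ := rfl

/-- The coordinate 1-form `dp^i`. -/
def dp (k : ℕ) (i : Fin k) : W k →ₗ[ℝ] ℝ where
  toFun Z := Z.2.2.2 i
  map_add' _ _ := rfl
  map_smul' _ _ := rfl

/-- The wedge `λ₁ ∧ … ∧ λ_k` of linear functionals, evaluated on vectors:
the determinant of the matrix with `(i,j)` entry `λ_i(v_j)`. -/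
noncomputable def wedge {k n : ℕ} (lam : Fin n → (W k →ₗ[ℝ] ℝ)) (v : Fin n → W k) : ℝ :=
  (Matrix.of fun i j => lam i (v j)).det

/-- The standard basis vector in the `x^μ` direction. -/
noncomputable def ex (k : ℕ) (μ : Fin (k + 1)) : W k := (Pi.single μ 1, 0, 0, 0)

/-- The volume form `ω = dx⁰ ∧ … ∧ dx^{m−1}` (`m = k + 1`). -/
noncomputable def vol (k : ℕ) (v : Fin (k + 1) → W k) : ℝ :=
  wedge (fun μ : Fin (k + 1) => dx k μ) v

/-- The `(m+2)`-form `Δ₀ = dφ ∧ dπ ∧ dx⁰ ∧ … ∧ dx^{m−1}` (`m = k+1`). -/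
noncomputable def Delta0 (k : ℕ) : (Fin (k + 3) → W k) → ℝ :=
  wedge (Fin.cons (dphi k) (Fin.cons (dpi k) (fun μ : Fin (k + 1) => dx k μ)))

/-- The `(m+2)`-form `Δ_i = dφ ∧ dp^i ∧ dx⁰ ∧ … ∧ dx^{m−1}` (`m = k+1`). -/
noncomputable def DeltaI (k : ℕ) (i : Fin k) : (Fin (k + 3) → W k) → ℝ :=
  wedge (Fin.cons (dphi k) (Fin.cons (dp k i) (fun μ : Fin (k + 1) => dx k μ)))

/-- `Ω̃_H = dφ ∧ dπ ∧ d^{m−1}x₀ + dφ ∧ dp^i ∧ d^{m−1}x_i`, i.e.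
`Ω̃_H(v₁,…,v_{m+1}) = Δ₀(e^x_0, v₁,…,v_{m+1}) + ∑_{i} Δ_i(e^x_{i+1}, v₁,…,v_{m+1})`. -/
noncomputable def OmegaTildeH (k : ℕ) (v : Fin (k + 2) → W k) : ℝ :=
  Delta0 k (Fin.cons (ex k 0) v)
    + ∑ i : Fin k, DeltaI k i (Fin.cons (ex k i.succ) v)

/-- A determinant whose `i`-th row vanishes away from column `0` reduces to a single cofactor. -/
theorem det_eq_of_row_eq_zero {n : ℕ} (M : Matrix (Fin (n + 1)) (Fin (n + 1)) ℝ)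
    (i : Fin (n + 1)) (h : ∀ j : Fin n, M i j.succ = 0) :
    M.det = (-1) ^ (i : ℕ) * M i 0 * (M.submatrix i.succAbove Fin.succ).det := by
  rw [Matrix.det_succ_row M i, Fin.sum_univ_succ]
  simp [h, Fin.succAbove_zero]

theorem dx_ex (k : ℕ) (μ ν : Fin (k + 1)) : dx k μ (ex k ν) = if μ = ν then 1 else 0 := by
  simp [dx, ex, Pi.single_apply]

/-- The volume form on `Z` and all basis vectors `e^x_ν` with `ν ≠ μ` is `± dx^μ(Z)`. -/
theorem vol_cons_ex (k : ℕ) (Z : W k) (μ : Fin (k + 1)) :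
    vol k (Fin.cons Z fun j => ex k (μ.succAbove j)) = (-1) ^ (μ : ℕ) * Z.1 μ := by
  have hone : ((Matrix.of fun i j => dx k i
      ((Fin.cons Z fun j => ex k (μ.succAbove j) : Fin (k + 1) → W k) j)).submatrix
        μ.succAbove Fin.succ) = 1 := by
    ext i j
    simp [dx_ex, Matrix.one_apply]
  rw [vol, wedge, det_eq_of_row_eq_zero _ μ, hone]
  · simp [dx]
  · intro j
    simp [dx_ex, (Fin.succAbove_ne μ j).symm]

/-- The momentum 1-forms, `dπ` in the time direction and `dp^i` in the direction `i + 1`. -/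
def dmom (k : ℕ) : Fin (k + 1) → (W k →ₗ[ℝ] ℝ) := Fin.cons (dpi k) (dp k)

theorem dphi_ex (k : ℕ) (ν : Fin (k + 1)) : dphi k (ex k ν) = 0 := rfl

theorem dmom_ex (k : ℕ) (μ ν : Fin (k + 1)) : dmom k μ (ex k ν) = 0 := by
  cases μ using Fin.cases <;> rfl

theorem OmegaTildeH_eq_sum (k : ℕ) (v : Fin (k + 2) → W k) :
    OmegaTildeH k v = ∑ μ : Fin (k + 1),
      wedge (Fin.cons (dphi k) (Fin.cons (dmom k μ) (dx k)))
        (Fin.cons (ex k μ) v : Fin (k + 3) → W k) := by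
  rw [Fin.sum_univ_succ]
  rfl

theorem wedge_eq_zero_of_eq {k n : ℕ} (lam : Fin n → (W k →ₗ[ℝ] ℝ)) (v : Fin n → W k)
    {i j : Fin n} (hij : i ≠ j) (h : v i = v j) : wedge lam v = 0 :=
  Matrix.det_zero_of_column_eq hij fun l => by simp [h]

theorem wedge_eq_zero_of_eq_zero {k n : ℕ} (lam : Fin n → (W k →ₗ[ℝ] ℝ)) (v : Fin n → W k)
    (j : Fin n) (h : v j = 0) : wedge lam v = 0 :=
  Matrix.det_eq_zero_of_column_eq_zero j fun i => by simp [h]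

/-- The wedge of a functional vanishing on all `e^x_ν` with the `dx^ν`, `ν ≠ μ`. -/
theorem wedge_cons_ex (k : ℕ) (α : W k →ₗ[ℝ] ℝ) (hα : ∀ ν, α (ex k ν) = 0) (Y : W k)
    (μ : Fin (k + 1)) :
    wedge (Fin.cons α fun j => dx k (μ.succAbove j))
      (Fin.cons Y fun j => ex k (μ.succAbove j) : Fin (k + 1) → W k) = α Y := by
  have hone : ((Matrix.of fun i j =>
      (Fin.cons α fun j => dx k (μ.succAbove j) : Fin (k + 1) → (W k →ₗ[ℝ] ℝ)) i
      ((Fin.cons Y fun j => ex k (μ.succAbove j) : Fin (k + 1) → W k) j)).submatrix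
        (Fin.succAbove 0) Fin.succ) = 1 := by
    ext i j
    simp [dx_ex, Matrix.one_apply]
  rw [wedge, det_eq_of_row_eq_zero _ 0, hone]
  · simp
  · intro j
    simp [hα]

/-- The wedge of two functionals vanishing on all `e^x_ν` with the `dx^ν`, `ν ≠ μ`. -/
theorem wedge_cons_cons_ex (k : ℕ) (α β : W k →ₗ[ℝ] ℝ) (hα : ∀ ν, α (ex k ν) = 0)
    (hβ : ∀ ν, β (ex k ν) = 0) (Y Z : W k) (μ : Fin (k + 1)) :
    wedge (Fin.cons α (Fin.cons β fun j => dx k (μ.succAbove j)))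
      (Fin.cons Y (Fin.cons Z fun j => ex k (μ.succAbove j)) : Fin (k + 2) → W k)
      = α Y * β Z - α Z * β Y := by
  rw [← wedge_cons_ex k β hβ Z μ, ← wedge_cons_ex k β hβ Y μ]
  simp only [wedge]
  rw [Matrix.det_succ_row_zero, Fin.sum_univ_succ, Fin.sum_univ_succ]
  have hsub : ∀ j : Fin (k + 1), (Fin.cons Y (Fin.cons Z fun j => ex k (μ.succAbove j)) :
      Fin (k + 2) → W k) (Fin.succAbove 1 j) =
      (Fin.cons Y fun j => ex k (μ.succAbove j) : Fin (k + 1) → W k) j := by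
    intro j
    cases j using Fin.cases with
    | zero => rfl
    | succ j => rw [← Fin.succ_zero_eq_one, Fin.succ_succAbove_succ]; simp
  simp [hα, Matrix.submatrix, hsub, sub_eq_add_neg]

/-- `Ω̃_H` on two vectors without spacetime components and all `e^x_ν` with `ν ≠ μ`. -/
theorem OmegaTildeH_cons_cons_ex (k : ℕ) (Y Z : W k) (hY : Y.1 = 0) (hZ : Z.1 = 0)
    (μ : Fin (k + 1)) :
    OmegaTildeH k (Fin.cons Y (Fin.cons Z fun j => ex k (μ.succAbove j)))
      = (-1) ^ (μ : ℕ) * (dphi k Y * dmom k μ Z - dphi k Z * dmom k μ Y) := by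
  rw [OmegaTildeH_eq_sum, Finset.sum_eq_single μ]
  · rw [← wedge_cons_cons_ex k _ _ (dphi_ex k) (dmom_ex k μ) Y Z μ, wedge,
      det_eq_of_row_eq_zero _ μ.succ.succ]
    · have hrow : ∀ i : Fin (k + 2),
          (Fin.cons (dphi k) (Fin.cons (dmom k μ) (dx k)) : Fin (k + 3) → (W k →ₗ[ℝ] ℝ))
            (μ.succ.succ.succAbove i) =
          (Fin.cons (dphi k) (Fin.cons (dmom k μ) fun j => dx k (μ.succAbove j)) :
            Fin (k + 2) → (W k →ₗ[ℝ] ℝ)) i := by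
        intro i
        cases i using Fin.cases with
        | zero => simp
        | succ i => cases i using Fin.cases <;> simp
      simp [dx_ex, wedge, Matrix.submatrix, hrow, pow_succ]
    · intro j
      cases j using Fin.cases with
      | zero => simp [dx, hY]
      | succ j =>
        cases j using Fin.cases with
        | zero => exact congrFun hZ μ
        | succ j => simp [dx_ex, (Fin.succAbove_ne μ j).symm]
  · intro ν _ hν
    obtain ⟨j, hj⟩ := Fin.exists_succAbove_eq hν
    exact wedge_eq_zero_of_eq _ _ (i := 0) (j := j.succ.succ.succ) (Fin.succ_ne_zero _).symm
      (by simp [hj])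
  · simp

/-- for the canonical Klein–Gordon multimomentum phase space,
`ker Ω̃_H ∩ ker ω = {0}`: no compatibility constraints arise in the Hamiltonian
formulation of the Klein–Gordon theory. -/
theorem stmt13 (k : ℕ) :
    ∀ Z : W k,
      ((∀ v : Fin (k + 2) → W k, (∃ j, v j = Z) → OmegaTildeH k v = 0) ∧
        (∀ w : Fin k → W k, vol k (Fin.cons Z w) = 0))
      ↔ Z = 0 := by
  intro Z
  constructor
  · rintro ⟨hΩ, hω⟩
    have ha : Z.1 = 0 := funext fun μ => by
      simpa [vol_cons_ex] using hω fun j => ex k (μ.succAbove j)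
    have key (Y : W k) (hY : Y.1 = 0) (μ : Fin (k + 1)) :
        dphi k Z * dmom k μ Y - dphi k Y * dmom k μ Z = 0 := by
      have h := hΩ (Fin.cons Z (Fin.cons Y fun j => ex k (μ.succAbove j))) ⟨0, rfl⟩
      rw [OmegaTildeH_cons_cons_ex k Z Y ha hY] at h
      simpa using h
    have hb : Z.2.1 = 0 := by simpa [dphi, dmom, dpi] using key (0, 0, 1, 0) rfl 0
    have hc : Z.2.2.1 = 0 := by simpa [dphi, dmom, dpi] using key (0, 1, 0, 0) rfl 0
    have hq : Z.2.2.2 = 0 := funext fun i => by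
      simpa [dphi, dmom, dp] using key (0, 1, 0, 0) rfl i.succ
    exact Prod.ext ha (Prod.ext hb (Prod.ext hc hq))
  · rintro rfl
    refine ⟨fun v ⟨j, hj⟩ => ?_, fun w => wedge_eq_zero_of_eq_zero _ _ 0 rfl⟩
    rw [OmegaTildeH_eq_sum]
    exact Finset.sum_eq_zero fun μ _ => wedge_eq_zero_of_eq_zero _ _ j.succ (by simpa using hj)

end Stmt13
end

section
/- For the electric Carrollian scalar multivelocity phase space, the common kernel {Z ∈ V : (Ω̃ vanishes whenever Z is one of its m+1 arguments) and (ω(Z, v₁, …, v_{m−1}) = 0 for all v₁,…,v_{m−1} ∈ V)} equals the set of Z = (a, b, c, u, w) with a = 0, b = 0, c = 0 and u, w arbitrary. That is, ker Ω̃ ∩ ker ω is the span of all multivelocity directions ∂/∂φ_μ and ∂/∂π_μ. -/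
namespace Stmt14

/-- The multivelocity phase space directions `(x^μ, φ, π, φ_μ, π_μ)`, `m = k + 1`. -/
abbrev V (m : ℕ) : Type := (Fin m → ℝ) × ℝ × ℝ × (Fin m → ℝ) × (Fin m → ℝ)

/-- The coordinate 1-form `dx^μ`. -/
def dx (m : ℕ) (μ : Fin m) : V m →ₗ[ℝ] ℝ where
  toFun Z := Z.1 μ
  map_add' _ _ := rfl
  map_smul' _ _ := rfl

/-- The coordinate 1-form `dφ`. -/
def dphi (m : ℕ) : V m →ₗ[ℝ] ℝ where
  toFun Z := Z.2.1
  map_add' _ _ := rfl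
  map_smul' _ _ := rfl

/-- The coordinate 1-form `dπ`. -/
def dpi (m : ℕ) : V m →ₗ[ℝ] ℝ where
  toFun Z := Z.2.2.1
  map_add' _ _ := rfl
  map_smul' _ _ := rfl

/-- The wedge `λ₁ ∧ … ∧ λ_k` of linear functionals, evaluated on vectors:
the determinant of the matrix with `(i,j)` entry `λ_i(v_j)`. -/
noncomputable def wedge {m k : ℕ} (lam : Fin k → (V m →ₗ[ℝ] ℝ)) (v : Fin k → V m) : ℝ :=
  (Matrix.of fun i j => lam i (v j)).det

/-- The standard basis vector in the `x^μ` direction. -/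
noncomputable def ex (m : ℕ) (μ : Fin m) : V m := (Pi.single μ 1, 0, 0, 0, 0)

/-- The volume form `ω = dx⁰ ∧ … ∧ dx^{m−1}`. -/
noncomputable def vol (m : ℕ) (v : Fin m → V m) : ℝ := wedge (fun μ => dx m μ) v

/-- The `(m+2)`-form `Δ = dφ ∧ dπ ∧ dx⁰ ∧ … ∧ dx^{m−1}` (`m = k+1`). -/
noncomputable def Delta (k : ℕ) : (Fin (k + 3) → V (k + 1)) → ℝ :=
  wedge (Fin.cons (dphi (k + 1)) (Fin.cons (dpi (k + 1)) (fun μ : Fin (k + 1) => dx (k + 1) μ)))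

/-- For the electric Carrollian scalar: `Ω̃ = dφ ∧ dπ ∧ d^{m−1}x₀`, i.e.
`Ω̃(v₁,…,v_{m+1}) = Δ(e^x_0, v₁,…,v_{m+1})` (`m = k+1`). -/
noncomputable def OmegaTilde (k : ℕ) (v : Fin (k + 2) → V (k + 1)) : ℝ :=
  Delta k (Fin.cons (ex (k + 1) 0) v)

/-- Replacing one vector of a dual family by `Z` and permuting the arguments evaluates the wedge
to a coordinate of `Z`, up to the sign of the permutation. -/
lemma wedge_update_comp_perm {m n : ℕ} (lam : Fin n → (V m →ₗ[ℝ] ℝ)) (e : Fin n → V m)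
    (he : ∀ i j, lam i (e j) = (1 : Matrix (Fin n) (Fin n) ℝ) i j) (j : Fin n) (Z : V m)
    (σ : Equiv.Perm (Fin n)) :
    wedge lam (Function.update e j Z ∘ σ) = (Equiv.Perm.sign σ : ℝ) * lam j Z := by
  have hmat : (Matrix.of fun i l => lam i ((Function.update e j Z ∘ σ) l)) =
      ((1 : Matrix (Fin n) (Fin n) ℝ).updateCol j (fun i => lam i Z)).submatrix id σ := by
    ext i l
    by_cases hl : σ l = j
    · simp [hl]
    · simp [hl, he]
  rw [wedge, hmat, Matrix.det_permute', ← Matrix.cramer_apply, Matrix.cramer_one]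
  rfl

lemma apply_eq_zero_of_wedge_update_comp_perm_eq_zero {m n : ℕ}
    {lam : Fin n → (V m →ₗ[ℝ] ℝ)} {e : Fin n → V m}
    (he : ∀ i j, lam i (e j) = (1 : Matrix (Fin n) (Fin n) ℝ) i j) {j : Fin n} {Z : V m}
    {σ : Equiv.Perm (Fin n)} (h : wedge lam (Function.update e j Z ∘ σ) = 0) :
    lam j Z = 0 := by
  rw [wedge_update_comp_perm lam e he] at h
  exact (mul_eq_zero.mp h).resolve_left (by simp)

lemma wedge_eq_zero_of_forall_apply_eq_zero {m n : ℕ} {lam : Fin n → (V m →ₗ[ℝ] ℝ)}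
    {v : Fin n → V m} (j : Fin n) (h : ∀ i, lam i (v j) = 0) : wedge lam v = 0 :=
  Matrix.det_eq_zero_of_column_eq_zero j h

lemma dx_ex (m : ℕ) (i j : Fin m) : dx m i (ex m j) = (1 : Matrix (Fin m) (Fin m) ℝ) i j := by
  simp [dx, ex, Pi.single_apply, Matrix.one_apply]

/-- The coordinate functionals whose wedge is `Delta k`. -/
def deltaForms (k : ℕ) : Fin (k + 3) → (V (k + 1) →ₗ[ℝ] ℝ) :=
  Fin.cons (dphi (k + 1)) (Fin.cons (dpi (k + 1)) (fun μ : Fin (k + 1) => dx (k + 1) μ))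

/-- The standard basis vectors dual to `deltaForms k`. -/
noncomputable def deltaVectors (k : ℕ) : Fin (k + 3) → V (k + 1) :=
  Fin.cons (0, 1, 0, 0, 0) (Fin.cons (0, 0, 1, 0, 0) (ex (k + 1)))

lemma deltaForms_deltaVectors (k : ℕ) (i j : Fin (k + 3)) :
    deltaForms k i (deltaVectors k j) = (1 : Matrix (Fin (k + 3)) (Fin (k + 3)) ℝ) i j := by
  refine Fin.cases ?_ (Fin.cases ?_ fun i => ?_) i <;>
    refine Fin.cases ?_ (Fin.cases ?_ fun j => ?_) j
  · simp [deltaForms, deltaVectors, dphi]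
  · exact (Matrix.one_apply_ne (Fin.succ_ne_zero _).symm).symm
  · exact (Matrix.one_apply_ne (Fin.succ_ne_zero _).symm).symm
  · exact (Matrix.one_apply_ne (Fin.succ_ne_zero _)).symm
  · simp [deltaForms, deltaVectors, dpi]
  · exact (Matrix.one_apply_ne ((Fin.succ_injective _).ne (Fin.succ_ne_zero _).symm)).symm
  · exact (Matrix.one_apply_ne (Fin.succ_ne_zero _)).symm
  · exact (Matrix.one_apply_ne ((Fin.succ_injective _).ne (Fin.succ_ne_zero _))).symm
  · simp [deltaForms, deltaVectors, dx_ex, Matrix.one_apply]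

lemma dx_eq_zero_of_vol_eq_zero {k : ℕ} {Z : V (k + 1)}
    (h : ∀ w : Fin k → V (k + 1), vol (k + 1) (Fin.cons Z w) = 0) (μ : Fin (k + 1)) :
    dx (k + 1) μ Z = 0 := by
  let v := Function.update (ex (k + 1)) μ Z ∘ Equiv.swap 0 μ
  have hv : Fin.cons Z (Fin.tail v) = v := by
    rw [← Fin.cons_self_tail v]
    simp [v]
  have hvol := h (Fin.tail v)
  rw [hv] at hvol
  exact apply_eq_zero_of_wedge_update_comp_perm_eq_zero (dx_ex (k + 1)) hvol

lemma deltaForms_eq_zero_of_OmegaTilde_eq_zero {k : ℕ} {Z : V (k + 1)}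
    (h : ∀ v : Fin (k + 2) → V (k + 1), (∃ j, v j = Z) → OmegaTilde k v = 0)
    {i : Fin (k + 3)} (hi : i ≠ Fin.succ (Fin.succ 0)) : deltaForms k i Z = 0 := by
  let σ : Equiv.Perm (Fin (k + 3)) := Equiv.swap 0 (Fin.succ (Fin.succ 0))
  let v := Function.update (deltaVectors k) i Z ∘ σ
  have hv : Fin.cons (ex (k + 1) 0) (Fin.tail v) = v := by
    rw [← Fin.cons_self_tail v]
    simp only [Fin.tail_cons]
    congr 1
    simp only [v, σ, Function.comp_apply, Equiv.swap_apply_left,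
      Function.update_of_ne hi.symm]
    rfl
  have hne : σ i ≠ 0 := fun h0 => hi (by simpa [σ] using congrArg σ h0)
  obtain ⟨j, hj⟩ := Fin.exists_succ_eq.mpr hne
  have hΩ := h (Fin.tail v) ⟨j, by simp [Fin.tail, v, hj, σ]⟩
  rw [OmegaTilde, hv] at hΩ
  exact apply_eq_zero_of_wedge_update_comp_perm_eq_zero (deltaForms_deltaVectors k) hΩ

/-- for the electric Carrollian scalar multivelocity phase space,
`ker Ω̃ ∩ ker ω` is exactly the span of all multivelocity directions `∂/∂φ_μ` and
`∂/∂π_μ`: it consists of the `Z = (a,b,c,u,w)` with `a = 0`, `b = 0`, `c = 0` and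
`u`, `w` arbitrary. -/
theorem stmt14 (k : ℕ) :
    ∀ Z : V (k + 1),
      ((∀ v : Fin (k + 2) → V (k + 1), (∃ j, v j = Z) → OmegaTilde k v = 0) ∧
        (∀ w : Fin k → V (k + 1), vol (k + 1) (Fin.cons Z w) = 0))
      ↔ (Z.1 = 0 ∧ Z.2.1 = 0 ∧ Z.2.2.1 = 0) := by
  intro Z
  constructor
  · rintro ⟨hΩ, hω⟩
    exact ⟨funext (dx_eq_zero_of_vol_eq_zero hω),
      deltaForms_eq_zero_of_OmegaTilde_eq_zero hΩ (Fin.succ_ne_zero _).symm,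
      deltaForms_eq_zero_of_OmegaTilde_eq_zero hΩ
        ((Fin.succ_injective _).ne (Fin.succ_ne_zero _).symm)⟩
  · rintro ⟨ha, hb, hc⟩
    have hdx (μ : Fin (k + 1)) : dx (k + 1) μ Z = 0 := congrFun ha μ
    refine ⟨?_, fun w => wedge_eq_zero_of_forall_apply_eq_zero 0 hdx⟩
    rintro v ⟨j, rfl⟩
    exact wedge_eq_zero_of_forall_apply_eq_zero j.succ (Fin.cases hb (Fin.cases hc hdx))

end Stmt14
end

section
/- For the multivelocity phase space of (2+1)-dimensional Chern–Simons gravity, the common kernel {Z ∈ V : (Ω̃_L vanishes whenever Z is one of its 4 arguments) and (ω(Z, v₁, v₂) = 0 for all v₁, v₂ ∈ V)} equals the set of Z = (a, E, W, u, s) with a = 0, E = 0, W = 0 and the velocity components u, s arbitrary. That is, ker Ω̃_L ∩ ker d³x is spanned by the multivelocity directions ∂/∂e^a_{σμ} and ∂/∂ω^a_{σμ}, so the field equations of 2+1 Chern–Simons gravity produce no compatibility constraints. -/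
namespace Stmt15

/-- The multivelocity phase space directions `(x^ν, e^a_μ, ω^c_ρ, e^a_{σμ}, ω^c_{σρ})`
of 2+1 Chern–Simons gravity. -/
abbrev V : Type :=
  (Fin 3 → ℝ) × (Fin 3 → Fin 3 → ℝ) × (Fin 3 → Fin 3 → ℝ) ×
    (Fin 3 → Fin 3 → Fin 3 → ℝ) × (Fin 3 → Fin 3 → Fin 3 → ℝ)

/-- The coordinate 1-form `dx^ν`. -/
def dx (ν : Fin 3) : V →ₗ[ℝ] ℝ where
  toFun Z := Z.1 ν
  map_add' _ _ := rfl
  map_smul' _ _ := rfl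

/-- The coordinate 1-form `de^a_μ`. -/
def de (a μ : Fin 3) : V →ₗ[ℝ] ℝ where
  toFun Z := Z.2.1 a μ
  map_add' _ _ := rfl
  map_smul' _ _ := rfl

/-- The coordinate 1-form `dω^c_ρ`. -/
def dom (c ρ : Fin 3) : V →ₗ[ℝ] ℝ where
  toFun Z := Z.2.2.1 c ρ
  map_add' _ _ := rfl
  map_smul' _ _ := rfl

/-- The wedge `λ₁ ∧ … ∧ λ_k` of linear functionals, evaluated on vectors:
the determinant of the matrix with `(i,j)` entry `λ_i(v_j)`. -/
noncomputable def wedge {k : ℕ} (lam : Fin k → (V →ₗ[ℝ] ℝ)) (v : Fin k → V) : ℝ :=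
  (Matrix.of fun i j => lam i (v j)).det

/-- The standard basis vector in the `x^ν` direction. -/
noncomputable def ex (ν : Fin 3) : V := (Pi.single ν 1, 0, 0, 0, 0)

/-- The pullback of the spacetime volume form, `ω = dx⁰ ∧ dx¹ ∧ dx²`. -/
noncomputable def vol (v : Fin 3 → V) : ℝ := wedge ![dx 0, dx 1, dx 2] v

/-- The Levi-Civita symbol on three indices, `ε₀₁₂ = 1`. -/
noncomputable def eps (μ ν ρ : Fin 3) : ℝ :=
  (((ν : ℕ) : ℝ) - ((μ : ℕ) : ℝ)) * (((ρ : ℕ) : ℝ) - ((ν : ℕ) : ℝ)) *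
    (((ρ : ℕ) : ℝ) - ((μ : ℕ) : ℝ)) / 2

/-- The 3×3 Minkowski metric `η = diag(−1, 1, 1)`. -/
noncomputable def eta : Matrix (Fin 3) (Fin 3) ℝ := !![(-1 : ℝ), 0, 0; 0, 1, 0; 0, 0, 1]

/-- The 5-form `Δ^{aμ}_{cρ} = de^a_μ ∧ dω^c_ρ ∧ dx⁰ ∧ dx¹ ∧ dx²`. -/
noncomputable def Delta (a μ c ρ : Fin 3) : (Fin 5 → V) → ℝ :=
  wedge ![de a μ, dom c ρ, dx 0, dx 1, dx 2]

/-- `Ω̃_L = −2 ε^{μνρ} η_{ac} de^a_μ ∧ dω^c_ρ ∧ d²x_ν`, i.e.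
`Ω̃_L(v₁,…,v₄) = −2 ∑_{μ,ν,ρ,a,c} ε^{μνρ} η_{ac} Δ^{aμ}_{cρ}(e^x_ν, v₁,…,v₄)`. -/
noncomputable def OmegaTildeL (v : Fin 4 → V) : ℝ :=
  -2 * ∑ μ : Fin 3, ∑ ν : Fin 3, ∑ ρ : Fin 3, ∑ a : Fin 3, ∑ c : Fin 3,
    eps μ ν ρ * eta a c * Delta a μ c ρ (Fin.cons (ex ν) v)

/-- The basis vector `∂/∂e^a_μ`. -/
noncomputable def ee (a μ : Fin 3) : V := (0, Pi.single a (Pi.single μ 1), 0, 0, 0)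

/-- The basis vector `∂/∂ω^c_ρ`. -/
noncomputable def eω (c ρ : Fin 3) : V := (0, 0, Pi.single c (Pi.single ρ 1), 0, 0)

/-- On two vertical vectors and two spacetime directions, the contraction of `Δ` by `e^x_ν`
factors into a two-form on the fibre and the Levi-Civita symbol. -/
lemma Delta_ex_vertical (a μ c ρ ν α β : Fin 3) {P Q : V} (hP : P.1 = 0) (hQ : Q.1 = 0) :
    Delta a μ c ρ (Fin.cons (ex ν) ![P, Q, ex α, ex β]) =
      (P.2.1 a μ * Q.2.2.1 c ρ - Q.2.1 a μ * P.2.2.1 c ρ) * eps ν α β := by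
  simp only [Delta, wedge]
  simp [Matrix.det_succ_row_zero, Fin.sum_univ_succ, Fin.succAbove, de, dom, dx, ex, hP, hQ]
  fin_cases ν <;> fin_cases α <;> fin_cases β <;> simp [eps] <;> ring

lemma OmegaTildeL_eω {Z : V} (hZ : Z.1 = 0) (a μ : Fin 3) :
    OmegaTildeL ![Z, eω a (μ + 2), ex μ, ex (μ + 2)] = 2 * eta a a * Z.2.1 a μ := by
  simp only [OmegaTildeL, Delta_ex_vertical _ _ _ _ _ _ _ hZ (show (eω a (μ + 2)).1 = 0 from rfl)]
  fin_cases a <;> fin_cases μ <;> simp [eω, eta, eps, Fin.sum_univ_three] <;> ring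

lemma OmegaTildeL_ee {Z : V} (hZ : Z.1 = 0) (c ρ : Fin 3) :
    OmegaTildeL ![Z, ee c (ρ + 2), ex ρ, ex (ρ + 2)] = 2 * eta c c * Z.2.2.1 c ρ := by
  simp only [OmegaTildeL, Delta_ex_vertical _ _ _ _ _ _ _ hZ (show (ee c (ρ + 2)).1 = 0 from rfl)]
  fin_cases c <;> fin_cases ρ <;> simp [ee, eta, eps, Fin.sum_univ_three] <;> ring

lemma eta_diag_ne_zero (a : Fin 3) : eta a a ≠ 0 := by
  fin_cases a <;> simp [eta]

lemma vol_ex (Z : V) (ν : Fin 3) : vol ![Z, ex (ν + 1), ex (ν + 2)] = Z.1 ν := by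
  fin_cases ν <;> simp [vol, wedge, Matrix.det_fin_three, dx, ex]

/-- A wedge vanishes when all its factors vanish on one of the arguments. -/
lemma wedge_eq_zero {k : ℕ} {lam : Fin k → (V →ₗ[ℝ] ℝ)} {v : Fin k → V} (j : Fin k)
    (h : ∀ i, lam i (v j) = 0) : wedge lam v = 0 :=
  Matrix.det_eq_zero_of_column_eq_zero j h

/-- for the multivelocity phase space of (2+1)-dimensional Chern–Simons
gravity, `ker Ω̃_L ∩ ker d³x` is exactly the span of the multivelocity directions
`∂/∂e^a_{σμ}` and `∂/∂ω^a_{σμ}`: it consists of the `Z = (a, E, W, u, s)` with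
`a = 0`, `E = 0`, `W = 0` and the velocity components `u`, `s` arbitrary; so the
field equations of 2+1 Chern–Simons gravity produce no compatibility constraints. -/
theorem stmt15 :
    ∀ Z : V,
      ((∀ v : Fin 4 → V, (∃ j, v j = Z) → OmegaTildeL v = 0) ∧
        (∀ v₁ v₂ : V, vol ![Z, v₁, v₂] = 0))
      ↔ (Z.1 = 0 ∧ Z.2.1 = 0 ∧ Z.2.2.1 = 0) := by
  intro Z
  constructor
  · rintro ⟨hΩ, hvol⟩
    have hZ : Z.1 = 0 := funext fun ν => (vol_ex Z ν).symm.trans (hvol _ _)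
    refine ⟨hZ, ?_, ?_⟩
    · ext a μ
      have h := (OmegaTildeL_eω hZ a μ).symm.trans (hΩ _ ⟨0, rfl⟩)
      simpa [eta_diag_ne_zero] using h
    · ext c ρ
      have h := (OmegaTildeL_ee hZ c ρ).symm.trans (hΩ _ ⟨0, rfl⟩)
      simpa [eta_diag_ne_zero] using h
  · rintro ⟨hx, hE, hW⟩
    refine ⟨?_, fun v₁ v₂ => wedge_eq_zero 0 fun i => ?_⟩
    · rintro v ⟨j, hj⟩
      have hΔ (a μ c ρ ν : Fin 3) : Delta a μ c ρ (Fin.cons (ex ν) v) = 0 :=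
        wedge_eq_zero j.succ fun i => by
          fin_cases i <;> simp [hj, de, dom, dx, hx, hE, hW]
      simp [OmegaTildeL, hΔ]
    · fin_cases i <;> simp [dx, hx]

end Stmt15
end
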